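/- (Moser Formula 2) There exist C > 0 and T₀ > 0 such that for all T ≥ T₀, all H with 0 < H ≤ T^{1/4}, and all t ∈ [T, T+H], setting P₀ := √(T/(2π)), one has | Z'(t) + 2·Σ_{n < P₀} (1/√n)·ln(P₀/n)·sin(θ(t) − t·ln n) | ≤ C·T^{−1/4}·ln T, the sum being over natural numbers n ≥ 1 with n < P₀. -/

import Mathlib

open Filter Topology

noncomputable def theta (t : ℝ) : ℝ :=
  (Complex.log (Complex.Gamma (1/4 + Complex.I * t / 2))).im - t / 2 * Real.log Real.pi

noncomputable def hardyZ (t : ℝ) : ℝ :=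
  (Complex.exp (Complex.I * theta t) * riemannZeta (1/2 + Complex.I * t)).re

namespace RiemannSiegel

open Complex MeasureTheory Set
open scoped Real ComplexConjugate

/-- The unit vector in the direction `exp (iπ/4)`. -/
noncomputable def rot : ℂ := ⟨√2 / 2, √2 / 2⟩

@[simp] lemma rot_re : rot.re = √2 / 2 := rfl

@[simp] lemma rot_im : rot.im = √2 / 2 := rfl

lemma sqrt_two_mul_self : √2 * √2 = (2 : ℝ) := Real.mul_self_sqrt (by norm_num)

lemma rot_mul_rot : rot * rot = I := by
  apply Complex.ext
  · simp
  · simp; linarith [sqrt_two_mul_self]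

lemma rot_mul_conj : rot * conj rot = 1 := by
  apply Complex.ext
  · simp; linarith [sqrt_two_mul_self]
  · simp

lemma I_mul_conj_rot : I * conj rot = rot := by
  rw [← rot_mul_rot, mul_assoc, rot_mul_conj, mul_one]

lemma rot_ne_zero : rot ≠ 0 := fun h => by
  have := rot_mul_conj
  simp [h] at this

lemma rot_eq_exp : rot = cexp (π / 4 * I) := by
  rw [show (π / 4 * I : ℂ) = ((π / 4 : ℝ) : ℂ) * I by push_cast; ring]
  apply Complex.ext
  · rw [exp_ofReal_mul_I_re, Real.cos_pi_div_four, rot_re]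
  · rw [exp_ofReal_mul_I_im, Real.sin_pi_div_four, rot_im]

lemma norm_rot : ‖rot‖ = 1 := by
  rw [rot_eq_exp, show (π / 4 * I : ℂ) = ((π / 4 : ℝ) : ℂ) * I by push_cast; ring,
    norm_exp_ofReal_mul_I]

/-- The integral of a holomorphic function with Gaussian decay over a horizontal line does not
depend on the line. -/
theorem integral_horizontal_shift {f : ℂ → ℂ} {y₁ y₂ C : ℝ} (hy : y₁ ≤ y₂)
    (hc : ContinuousOn f {z | z.im ∈ Icc y₁ y₂})
    (hd : DifferentiableOn ℂ f {z | z.im ∈ Ioo y₁ y₂})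
    (hb : ∀ x : ℝ, ∀ y ∈ Icc y₁ y₂, ‖f (x + y * I)‖ ≤ C * Real.exp (-x ^ 2)) :
    ∫ x : ℝ, f (x + y₁ * I) = ∫ x : ℝ, f (x + y₂ * I) := by
  have hInt : ∀ y ∈ Icc y₁ y₂, Integrable fun x : ℝ => f (x + y * I) := by
    intro y hy'
    have hcont : Continuous fun x : ℝ => f (x + y * I) :=
      hc.comp_continuous (by fun_prop) (fun x => by simpa using hy')
    refine Integrable.mono' (g := fun x => C * Real.exp (-x ^ 2)) ?_
      hcont.aestronglyMeasurable (Eventually.of_forall fun x => hb x y hy')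
    simpa using (integrable_exp_neg_mul_sq (b := 1) one_pos).const_mul C
  have hrect : ∀ R : ℝ, (∫ x : ℝ in (-R)..R, f (x + y₁ * I)) -
      (∫ x : ℝ in (-R)..R, f (x + y₂ * I)) =
      I • (∫ y : ℝ in y₁..y₂, f ((-R : ℝ) + y * I)) - I • (∫ y : ℝ in y₁..y₂, f (R + y * I)) := by
    intro R
    have := integral_boundary_rect_eq_zero_of_continuousOn_of_differentiableOn f
      (⟨-R, y₁⟩ : ℂ) ⟨R, y₂⟩
      (hc.mono fun z hz => by simpa [uIcc_of_le hy] using hz.2)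
      (hd.mono fun z hz => by simpa [hy] using hz.2)
    simp only at this
    rw [sub_eq_sub_iff_add_eq_add]
    linear_combination this
  have hside : ∀ g : ℝ → ℝ, (∀ R, g R ^ 2 = R ^ 2) →
      Tendsto (fun R : ℝ => I • ∫ y : ℝ in y₁..y₂, f (g R + y * I)) atTop (𝓝 0) := by
    intro g hg
    have hz : Tendsto (fun R : ℝ => C * Real.exp (-R ^ 2) * |y₂ - y₁|) atTop (𝓝 0) := by
      have : Tendsto (fun R : ℝ => Real.exp (-R ^ 2)) atTop (𝓝 0) :=
        Real.tendsto_exp_neg_atTop_nhds_zero.comp (tendsto_pow_atTop two_ne_zero)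
      simpa using (this.const_mul C).mul_const |y₂ - y₁|
    refine squeeze_zero_norm (fun R => ?_) hz
    rw [norm_smul, norm_I, one_mul]
    refine intervalIntegral.norm_integral_le_of_norm_le_const fun y hy' => ?_
    rw [uIoc_of_le hy] at hy'
    rw [← hg R]
    exact hb (g R) y (Ioc_subset_Icc_self hy')
  have h1 := intervalIntegral_tendsto_integral (hInt y₁ ⟨le_rfl, hy⟩)
    tendsto_neg_atTop_atBot tendsto_id
  have h2 := intervalIntegral_tendsto_integral (hInt y₂ ⟨hy, le_rfl⟩)
    tendsto_neg_atTop_atBot tendsto_id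
  have h3 := (hside (fun R => -R) (by simp)).sub (hside id (by simp))
  refine sub_eq_zero.1 (tendsto_nhds_unique ((h1.sub h2).congr fun R => ?_) (by simpa using h3))
  simpa using hrect R

/-- The point with parameter `u` on the line of slope `1` through the real number `a`. -/
noncomputable def line (a u : ℝ) : ℂ := a + rot * u

@[simp] lemma line_re (a u : ℝ) : (line a u).re = a + √2 / 2 * u := by simp [line]

@[simp] lemma line_im (a u : ℝ) : (line a u).im = √2 / 2 * u := by simp [line]

lemma continuous_line (a : ℝ) : Continuous (line a) := by unfold line; fun_prop

/-- The integral of a holomorphic function with Gaussian decay over a line of slope `1` does not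
depend on the line. -/
theorem integral_line_shift {f : ℂ → ℂ} {a b C : ℝ} (hab : a ≤ b)
    (hc : ContinuousOn f {z | z.re - z.im ∈ Icc a b})
    (hd : DifferentiableOn ℂ f {z | z.re - z.im ∈ Ioo a b})
    (hb : ∀ u : ℝ, ∀ c ∈ Icc a b, ‖f (line c u)‖ ≤ C * Real.exp (-2 * u ^ 2)) :
    ∫ u : ℝ, f (line a u) = ∫ u : ℝ, f (line b u) := by
  have hs2 : (0:ℝ) < √2 := by positivity
  have key : ∀ z : ℂ, (rot * z).re - (rot * z).im = -√2 * z.im := by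
    intro z; simp; ring
  have hpt : ∀ c u : ℝ, rot * ((u + √2 / 2 * c : ℝ) + (-√2 / 2 * c : ℝ) * I) = line c u := by
    intro c u
    apply Complex.ext
    · simp; linear_combination (c / 2) * sqrt_two_mul_self
    · simp; ring
  have hmul : ∀ c : ℝ, √2 * (-√2 / 2 * c) = -c := fun c => by
    linear_combination (-c / 2) * sqrt_two_mul_self
  have hC : 0 ≤ C := by
    have := (norm_nonneg _).trans (hb 0 a ⟨le_rfl, hab⟩)
    simpa using this
  have := integral_horizontal_shift (f := fun z => f (rot * z)) (y₁ := -√2 / 2 * b)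
    (y₂ := -√2 / 2 * a) (C := C * Real.exp ((|a| + |b|) ^ 2)) (by nlinarith) ?_ ?_ ?_
  · have hc' : ∀ c : ℝ, ∫ x : ℝ, f (rot * (x + (-√2 / 2 * c : ℝ) * I)) =
        ∫ u : ℝ, f (line c u) := by
      intro c
      rw [← integral_add_right_eq_self _ (√2 / 2 * c)]
      simp only [← hpt]
    rw [hc', hc'] at this
    exact this.symm
  · refine hc.comp (by fun_prop) fun z hz => ?_
    simp only [mem_ofPred_eq, mem_Icc] at hz ⊢
    rw [key]
    constructor <;> linarith [mul_le_mul_of_nonneg_left hz.1 hs2.le,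
      mul_le_mul_of_nonneg_left hz.2 hs2.le, hmul a, hmul b]
  · refine hd.comp (by fun_prop) fun z hz => ?_
    simp only [mem_ofPred_eq, mem_Ioo] at hz ⊢
    rw [key]
    constructor <;> linarith [mul_lt_mul_of_pos_left hz.1 hs2,
      mul_lt_mul_of_pos_left hz.2 hs2, hmul a, hmul b]
  · intro x y hy
    have hc : -√2 * y ∈ Icc a b := by
      constructor <;> linarith [mul_le_mul_of_nonneg_left hy.1 hs2.le,
        mul_le_mul_of_nonneg_left hy.2 hs2.le, hmul a, hmul b]
    set c := -√2 * y with hcdef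
    have hyc : y = -√2 / 2 * c := by
      rw [hcdef]; linear_combination (-y / 2) * sqrt_two_mul_self
    have hx : x = (x - √2 / 2 * c) + √2 / 2 * c := by ring
    have hcabs : c ^ 2 ≤ (|a| + |b|) ^ 2 := by
      refine sq_le_sq.2 ?_
      rw [abs_of_nonneg (by positivity : 0 ≤ |a| + |b|)]
      exact abs_le.2 ⟨by linarith [hc.1, neg_abs_le a, abs_nonneg b],
        by linarith [hc.2, le_abs_self b, abs_nonneg a]⟩
    calc ‖f (rot * (x + y * I))‖ = ‖f (line c (x - √2 / 2 * c))‖ := by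
          rw [← hpt, ← hyc, ← hx]
      _ ≤ C * Real.exp (-2 * (x - √2 / 2 * c) ^ 2) := hb _ c hc
      _ ≤ C * Real.exp ((|a| + |b|) ^ 2 + -x ^ 2) := by
          gcongr
          nlinarith [sq_nonneg (x - √2 * c), sqrt_two_mul_self]
      _ = _ := by rw [Real.exp_add, mul_assoc]

lemma norm_sin_sq (z : ℂ) : ‖sin z‖ ^ 2 = Real.sin z.re ^ 2 + Real.sinh z.im ^ 2 := by
  have h : sin z = (Real.sin z.re * Real.cosh z.im : ℝ) + (Real.cos z.re * Real.sinh z.im : ℝ) * I := by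
    rw [Complex.sin_eq]; push_cast; ring
  rw [← normSq_eq_norm_sq, h, normSq_add_mul_I]
  nlinarith [Real.cosh_sq z.im, Real.sin_sq_add_cos_sq z.re]

lemma abs_le_abs_sinh (x : ℝ) : |x| ≤ |Real.sinh x| := by
  rw [Real.abs_sinh]
  exact Real.self_le_sinh_iff.2 (abs_nonneg x)

lemma abs_im_le_norm_sin (z : ℂ) : |z.im| ≤ ‖sin z‖ := by
  refine abs_le_of_sq_le_sq' ?_ (norm_nonneg _) |> abs_le.2 |> fun h => by simpa using h
  rw [norm_sin_sq]
  have := sq_le_sq.2 (abs_le_abs_sinh z.im)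
  nlinarith [sq_nonneg (Real.sin z.re)]

/-- The kernel of the Riemann–Siegel integral. -/
noncomputable def ker (x : ℂ) : ℂ := cexp (I * π * x ^ 2) / (2 * I * sin (π * x))

lemma norm_cexp_line (a u : ℝ) :
    ‖cexp (I * π * line a u ^ 2)‖ = Real.exp (-π * u ^ 2 - √2 * π * a * u) := by
  rw [norm_exp]
  congr 1
  have : (I * π * line a u ^ 2).re = -2 * π * ((line a u).re * (line a u).im) := by
    simp [pow_two]; ring
  rw [this, line_re, line_im]
  linear_combination (-π * u ^ 2 / 2) * sqrt_two_mul_self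

lemma one_le_norm_sin_line (N : ℕ) (u : ℝ) : 1 ≤ ‖sin (π * line (N + 1 / 2) u)‖ := by
  have h : 1 ≤ ‖sin (π * line (N + 1 / 2) u)‖ ^ 2 := by
    rw [norm_sin_sq]
    have hre : (π * line (N + 1 / 2) u).re = (π * (√2 / 2 * u) + π / 2) + N * π := by
      simp; ring
    have him : (π * line (N + 1 / 2) u).im = π * (√2 / 2 * u) := by simp
    rw [hre, him, Real.sin_add_nat_mul_pi, Real.sin_add_pi_div_two, mul_pow, ← pow_mul,
      mul_comm N 2, pow_mul]
    have h1 := sq_le_sq.2 (abs_le_abs_sinh (π * (√2 / 2 * u)))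
    have h2 := Real.one_sub_sq_div_two_le_cos (x := π * (√2 / 2 * u))
    have h3 : Real.sin (π * (√2 / 2 * u)) ^ 2 ≤ (π * (√2 / 2 * u)) ^ 2 :=
      sq_le_sq.2 Real.abs_sin_le_abs
    have h4 := Real.sin_sq_add_cos_sq (π * (√2 / 2 * u))
    norm_num
    linarith
  nlinarith [norm_nonneg (sin (π * line (N + 1 / 2) u))]

lemma sin_line_ne_zero (N : ℕ) (u : ℝ) : sin (π * line (N + 1 / 2) u) ≠ 0 := by
  intro h
  have := one_le_norm_sin_line N u
  rw [h, norm_zero] at this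
  linarith

lemma norm_ker_line_le (N : ℕ) (u : ℝ) :
    ‖ker (line (N + 1 / 2) u)‖ ≤ Real.exp (-π * u ^ 2 - √2 * π * (N + 1 / 2) * u) := by
  rw [ker, norm_div, norm_cexp_line]
  refine div_le_self (Real.exp_pos _).le ?_
  rw [norm_mul, norm_mul, norm_I]
  norm_num
  linarith [one_le_norm_sin_line N u]

lemma continuous_ker_line (N : ℕ) : Continuous fun u => ker (line (N + 1 / 2) u) := by
  unfold ker
  have := continuous_line (N + 1 / 2)
  refine Continuous.div (by fun_prop) (by fun_prop) fun u => ?_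
  simpa using sin_line_ne_zero N u

lemma gaussian_exponent_le (B u : ℝ) : -π * u ^ 2 + B * |u| ≤ -2 * u ^ 2 + B ^ 2 := by
  have h1 : (1:ℝ) ≤ π - 2 := by linarith [Real.pi_gt_three]
  nlinarith [sq_nonneg (B - |u|), sq_abs u, sq_nonneg u, sq_nonneg B, sq_nonneg (B - 2 * |u|)]

lemma linear_exponent_le {c c₀ : ℝ} (hc : |c| ≤ c₀) (u : ℝ) : -√2 * π * c * u ≤ 6 * c₀ * |u| := by
  have h2 : √2 * π ≤ 6 := by
    nlinarith [Real.sqrt_two_lt_three_halves, Real.pi_lt_four, Real.pi_pos, Real.sqrt_nonneg 2]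
  calc -√2 * π * c * u ≤ |-√2 * π * c * u| := le_abs_self _
    _ = √2 * π * |c| * |u| := by
        rw [abs_mul, abs_mul, abs_mul, abs_neg, abs_of_nonneg (Real.sqrt_nonneg 2),
          abs_of_pos Real.pi_pos]
    _ ≤ 6 * c₀ * |u| := by gcongr

lemma norm_cexp_line_mul_le {c c₀ : ℝ} (hc : |c| ≤ c₀) (A B u : ℝ) :
    ‖cexp (I * π * line c u ^ 2)‖ * Real.exp (A + B * |u|) ≤
      Real.exp (A + (6 * c₀ + B) ^ 2) * Real.exp (-2 * u ^ 2) := by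
  rw [norm_cexp_line, ← Real.exp_add, ← Real.exp_add]
  refine Real.exp_le_exp.2 ?_
  linarith [gaussian_exponent_le (6 * c₀ + B) u, linear_exponent_le hc u]

lemma norm_ker_line_mul_le (N : ℕ) (A B u : ℝ) :
    ‖ker (line (N + 1 / 2) u)‖ * Real.exp (A + B * |u|) ≤
      Real.exp (A + (6 * (N + 1 / 2) + B) ^ 2) * Real.exp (-2 * u ^ 2) := by
  refine le_trans ?_ (norm_cexp_line_mul_le
    (abs_of_nonneg (by positivity : (0:ℝ) ≤ N + 1 / 2)).le A B u)
  gcongr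
  rw [norm_cexp_line]
  exact norm_ker_line_le N u

lemma integrable_exp_neg_two_mul_sq : Integrable fun u : ℝ => Real.exp (-2 * u ^ 2) :=
  integrable_exp_neg_mul_sq two_pos

lemma integrable_ker_mul {N : ℕ} {h : ℝ → ℂ} (hm : AEStronglyMeasurable h) {A B : ℝ}
    (hh : ∀ u, ‖h u‖ ≤ Real.exp (A + B * |u|)) :
    Integrable fun u => ker (line (N + 1 / 2) u) * h u := by
  refine Integrable.mono' (integrable_exp_neg_two_mul_sq.const_mul
    (Real.exp (A + (6 * (N + 1 / 2) + B) ^ 2)))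
    ((continuous_ker_line N).aestronglyMeasurable.mul hm) (Eventually.of_forall fun u => ?_)
  rw [norm_mul]
  refine le_trans ?_ (norm_ker_line_mul_le N A B u)
  gcongr
  exact hh u

/-- The integral of `g` against the Riemann–Siegel kernel over the line of slope `1` through
`N + 1/2`. -/
noncomputable def lineIntegral (N : ℕ) (g : ℂ → ℂ) : ℂ :=
  ∫ u : ℝ, ker (line (N + 1 / 2) u) * g (line (N + 1 / 2) u) * rot

lemma sin_ne_zero_of_mem_strip {N : ℕ} {x : ℂ}
    (hx : x.re - x.im ∈ Icc ((N : ℝ) + 1 / 2) (N + 1 + 1 / 2)) (hp : x ≠ N + 1) :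
    sin (π * x) ≠ 0 := by
  intro h
  obtain ⟨k, hk⟩ := Complex.sin_eq_zero_iff.1 h
  have hxk : x = k := by
    have : (π : ℂ) ≠ 0 := by exact_mod_cast Real.pi_ne_zero
    apply mul_left_cancel₀ this
    rw [hk, mul_comm]
  subst hxk
  simp only [intCast_re, intCast_im, sub_zero, mem_Icc] at hx
  apply hp
  have h1 : (N : ℤ) < k := by
    have : ((N : ℤ) : ℝ) < k := by push_cast; linarith
    exact_mod_cast this
  have h2 : k < N + 2 := by
    have : (k : ℝ) < ((N + 2 : ℤ) : ℝ) := by push_cast; linarith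
    exact_mod_cast this
  have : k = N + 1 := by omega
  rw [this]; push_cast; rfl

lemma integrable_ker_line {N : ℕ} {g : ℂ → ℂ} {A B : ℝ}
    (hc : Continuous fun u => g (line (N + 1 / 2) u))
    (hb : ∀ u, ‖g (line (N + 1 / 2) u)‖ ≤ Real.exp (A + B * |u|)) :
    Integrable fun u : ℝ => ker (line (N + 1 / 2) u) * g (line (N + 1 / 2) u) * rot :=
  (integrable_ker_mul hc.aestronglyMeasurable hb).mul_const _

/-- Moving the line of integration across the pole at `N + 1`, up to a constant that does not
depend on the integrand. -/
theorem lineIntegral_succ_sub_aux {N : ℕ} {g : ℂ → ℂ} {U : Set ℂ} (hU : IsOpen U) {A B : ℝ}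
    (hB : 0 ≤ B) (hsub : {x : ℂ | x.re - x.im ∈ Icc ((N : ℝ) + 1 / 2) (N + 1 + 1 / 2)} ⊆ U)
    (hg : DifferentiableOn ℂ g U)
    (hb : ∀ u : ℝ, ∀ c ∈ Icc ((N : ℝ) + 1 / 2) (N + 1 + 1 / 2),
      ‖g (line c u)‖ ≤ Real.exp (A + B * |u|)) :
    lineIntegral (N + 1) g - lineIntegral N g =
      g (N + 1) * (lineIntegral (N + 1) (fun _ => 1) - lineIntegral N (fun _ => 1)) := by
  set p : ℂ := N + 1 with hp
  set S : ℂ → ℂ := fun x => sin (π * x) with hS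
  set strip : Set ℂ := {x : ℂ | x.re - x.im ∈ Icc ((N : ℝ) + 1 / 2) (N + 1 + 1 / 2)} with hstrip
  have hSd : Differentiable ℂ S := by rw [hS]; fun_prop
  have hpstrip : p ∈ strip := by simp [hstrip, hp]; norm_num
  have hSp : S p = 0 := by
    rw [hS, hp]
    have : (π * (N + 1) : ℂ) = ((N + 1 : ℕ) : ℂ) * π := by push_cast; ring
    simp only [this, sin_nat_mul_pi]
  have hdS : Differentiable ℂ (dslope S p) := by
    intro x
    have := (differentiableOn_dslope (f := S) (c := p) (s := univ) univ_mem).2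
      hSd.differentiableOn
    exact this.differentiableAt univ_mem
  have hdg : DifferentiableOn ℂ (dslope g p) U :=
    (differentiableOn_dslope (hU.mem_nhds (hsub hpstrip))).2 hg
  have hne : ∀ x ∈ strip, dslope S p x ≠ 0 := by
    intro x hx
    by_cases hxp : x = p
    · rw [hxp, dslope_same]
      have hder : HasDerivAt S (cos (π * p) * π) p := by
        have := (hasDerivAt_sin (π * p)).comp p ((hasDerivAt_id p).const_mul (π : ℂ))
        simpa [hS, Function.comp_def] using this
      rw [hder.deriv]
      refine mul_ne_zero ?_ (by exact_mod_cast Real.pi_ne_zero)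
      intro h0
      have := sin_sq_add_cos_sq (π * p)
      rw [h0, show sin (π * p) = 0 from hSp] at this
      simp at this
    · rw [dslope_of_ne _ hxp, slope_def_field, hSp, sub_zero]
      exact div_ne_zero (sin_ne_zero_of_mem_strip hx hxp) (sub_ne_zero.2 hxp)
  set f : ℂ → ℂ := fun x => cexp (I * π * x ^ 2) * dslope g p x / (2 * I * dslope S p x) with hf
  have hfval : ∀ x, x ≠ p → f x = ker x * (g x - g p) := by
    intro x hx
    have hx' : x - p ≠ 0 := sub_ne_zero.2 hx
    simp only [hf, ker, dslope_of_ne _ hx, slope_def_field, hSp, sub_zero]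
    by_cases h0 : sin (π * x) = 0
    · simp [hS, h0]
    · rw [hS]; field_simp
  have hfd : ∀ x ∈ strip, DifferentiableAt ℂ f x := by
    intro x hx
    have h1 : DifferentiableAt ℂ (dslope g p) x := hdg.differentiableAt (hU.mem_nhds (hsub hx))
    have h2 : DifferentiableAt ℂ (dslope S p) x := hdS x
    exact DifferentiableAt.div (by fun_prop) (by fun_prop) (by simpa using hne x hx)
  have hfc : ContinuousOn f strip := fun x hx => (hfd x hx).continuousAt.continuousWithinAt
  -- bound near the pole by compactness
  obtain ⟨M, hM⟩ : ∃ M, ∀ c ∈ Icc ((N : ℝ) + 1 / 2) (N + 1 + 1 / 2), ∀ u ∈ Icc (-1 : ℝ) 1,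
      ‖f (line c u)‖ ≤ M := by
    have hcpt : IsCompact (Icc ((N : ℝ) + 1 / 2) (N + 1 + 1 / 2) ×ˢ Icc (-1 : ℝ) 1) :=
      isCompact_Icc.prod isCompact_Icc
    have hcont : ContinuousOn (fun q : ℝ × ℝ => f (line q.1 q.2))
        (Icc ((N : ℝ) + 1 / 2) (N + 1 + 1 / 2) ×ˢ Icc (-1 : ℝ) 1) := by
      refine hfc.comp (by unfold line; fun_prop) fun q hq => ?_
      simpa [hstrip] using hq.1
    obtain ⟨M, hM⟩ := hcpt.exists_bound_of_continuousOn hcont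
    exact ⟨M, fun c hc u hu => hM (c, u) ⟨hc, hu⟩⟩
  have hM0 : 0 ≤ M := (norm_nonneg _).trans (hM (N + 1) (by constructor <;> linarith) 0 (by simp))
  set A' := Real.log (Real.exp A + ‖g p‖) with hA'
  have hbound : ∀ u : ℝ, ∀ c ∈ Icc ((N : ℝ) + 1 / 2) (N + 1 + 1 / 2), ‖f (line c u)‖ ≤
      (M * Real.exp 2 + Real.exp (A' + (6 * (N + 2) + B) ^ 2)) * Real.exp (-2 * u ^ 2) := by
    intro u c hc
    rcases le_or_gt |u| 1 with hu | hu
    · refine (hM c hc u (abs_le.1 hu)).trans ?_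
      have h1 : 1 ≤ Real.exp 2 * Real.exp (-2 * u ^ 2) := by
        rw [← Real.exp_add]
        apply Real.one_le_exp
        nlinarith [abs_le.1 hu]
      have h2 : 0 ≤ Real.exp (A' + (6 * (N + 2) + B) ^ 2) * Real.exp (-2 * u ^ 2) := by positivity
      nlinarith
    · have hxp : line c u ≠ p := by
        intro h
        have := congrArg Complex.im h
        simp [hp] at this
        rw [this] at hu; simp at hu; linarith
      have hsin : 1 ≤ ‖sin (π * line c u)‖ := by
        refine le_trans ?_ (abs_im_le_norm_sin _)
        simp only [im_ofReal_mul, line_im, abs_mul, abs_of_pos Real.pi_pos]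
        rw [abs_of_nonneg (by positivity : 0 ≤ √2 / 2)]
        have h1 : 1 ≤ √2 := by rw [Real.one_le_sqrt]; norm_num
        have h2 := Real.pi_gt_three
        nlinarith [mul_le_mul h1 hu.le (by norm_num) (by positivity)]
      have hker : ‖ker (line c u)‖ ≤ ‖cexp (I * π * line c u ^ 2)‖ := by
        rw [ker, norm_div]
        refine div_le_self (norm_nonneg _) ?_
        rw [norm_mul, norm_mul, norm_I]
        norm_num
        linarith
      have hgb : ‖g (line c u) - g p‖ ≤ Real.exp (A' + B * |u|) := by
        refine (norm_sub_le _ _).trans ?_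
        rw [Real.exp_add, hA', Real.exp_log (by positivity), add_mul, ← Real.exp_add]
        refine add_le_add (hb u c hc) ?_
        exact le_mul_of_one_le_right (norm_nonneg _) (Real.one_le_exp (by positivity))
      have hcabs : |c| ≤ N + 2 := by
        rw [abs_of_nonneg (by linarith [hc.1, (Nat.cast_nonneg N : (0:ℝ) ≤ N)])]
        linarith [hc.2]
      rw [hfval _ hxp, norm_mul]
      calc _ ≤ ‖cexp (I * π * line c u ^ 2)‖ * Real.exp (A' + B * |u|) := by gcongr
        _ ≤ _ := norm_cexp_line_mul_le hcabs A' B u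
        _ ≤ _ := by
          gcongr
          have : 0 ≤ M * Real.exp 2 := by positivity
          linarith
  have hshift := integral_line_shift (f := f) (a := N + 1 / 2) (b := N + 1 + 1 / 2)
    (by linarith) hfc
    (fun x hx => (hfd x (Ioo_subset_Icc_self hx)).differentiableWithinAt) hbound
  have hmem : ∀ c ∈ Icc ((N : ℝ) + 1 / 2) (N + 1 + 1 / 2), ∀ u, line c u ∈ strip := by
    intro c hc u; simpa [hstrip] using hc
  have hgcont : ∀ c ∈ Icc ((N : ℝ) + 1 / 2) (N + 1 + 1 / 2), Continuous fun u => g (line c u) :=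
    fun c hc => hg.continuousOn.comp_continuous (continuous_line c) fun u => hsub (hmem c hc u)
  have hval : ∀ n : ℕ, (n : ℝ) + 1 / 2 ∈ Icc ((N : ℝ) + 1 / 2) (N + 1 + 1 / 2) →
      (∫ u : ℝ, f (line (n + 1 / 2) u)) * rot =
        lineIntegral n g - g p * lineIntegral n (fun _ => 1) := by
    intro n hn
    have hnp : ∀ u, line (n + 1 / 2) u ≠ p := by
      intro u h
      have := sin_line_ne_zero n u
      rw [h] at this
      exact this hSp
    rw [lineIntegral, lineIntegral, ← integral_const_mul, ← integral_sub,
      ← integral_mul_const]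
    · congr 1; ext u
      rw [hfval _ (hnp u)]; ring
    · exact integrable_ker_line (hgcont _ hn) (fun u => hb u _ hn)
    · exact (integrable_ker_line (g := fun _ => 1) (A := 0) (B := 0) continuous_const
        (fun u => by simp)).const_mul _
  have e1 := hval N (by constructor <;> linarith)
  have e2 := hval (N + 1) (by push_cast; constructor <;> linarith)
  push_cast at e2
  rw [← hshift] at e2
  linear_combination e1 - e2

/-- The exponential `x ↦ exp (2πixy)`. -/
noncomputable def expo (y x : ℂ) : ℂ := cexp (2 * π * I * x * y)

lemma norm_line_le (a u : ℝ) : ‖line a u‖ ≤ |a| + |u| := by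
  rw [line]
  refine (norm_add_le _ _).trans ?_
  simp [norm_rot]

lemma norm_expo_line_le (y : ℂ) {c c₀ : ℝ} (hc : |c| ≤ c₀) (u : ℝ) :
    ‖expo y (line c u)‖ ≤ Real.exp (2 * π * ‖y‖ * c₀ + 2 * π * ‖y‖ * |u|) := by
  refine (norm_exp_le_exp_norm _).trans (Real.exp_le_exp.2 ?_)
  have : ‖2 * π * I * line c u * y‖ = 2 * π * ‖y‖ * ‖line c u‖ := by
    simp [abs_of_pos Real.pi_pos]; ring
  rw [this, ← mul_add]
  gcongr
  exact (norm_line_le c u).trans (by linarith)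

lemma continuous_expo (y : ℂ) : Continuous (expo y) := by unfold expo; fun_prop

lemma integrable_ker_expo (N : ℕ) (y : ℂ) :
    Integrable fun u : ℝ => ker (line (N + 1 / 2) u) * expo y (line (N + 1 / 2) u) * rot :=
  integrable_ker_line ((continuous_expo y).comp (continuous_line _))
    (norm_expo_line_le y (abs_of_nonneg (by positivity : (0:ℝ) ≤ N + 1 / 2)).le)

/-- A Gaussian integral evaluates the difference operator in the frequency variable. -/
lemma lineIntegral_expo_add_one (N : ℕ) (y : ℂ) :
    lineIntegral N (expo (y + 1)) - lineIntegral N (expo y) =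
      rot * cexp (-I * π * (y + 1 / 2) ^ 2) := by
  rw [lineIntegral, lineIntegral, ← integral_sub (integrable_ker_expo N _) (integrable_ker_expo N _)]
  set a : ℝ := N + 1 / 2 with ha
  have hquad := integral_cexp_quadratic (b := -π) (by simp [Real.pi_pos])
    (2 * π * I * rot * (a + y + 1 / 2)) (I * π * a ^ 2 + 2 * π * I * a * (y + 1 / 2))
  have hpi : (π : ℂ) ≠ 0 := by exact_mod_cast Real.pi_ne_zero
  rw [neg_neg, div_self hpi, one_cpow, one_mul] at hquad
  have hexp : (I * π * a ^ 2 + 2 * π * I * a * (y + 1 / 2)) -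
      (2 * π * I * rot * (a + y + 1 / 2)) ^ 2 / (4 * -π) = -I * π * (y + 1 / 2) ^ 2 := by
    have : (2 * π * I * rot * (a + y + 1 / 2)) ^ 2 = -4 * π ^ 2 * I * (a + y + 1 / 2) ^ 2 := by
      have : (2 * π * I * rot * (a + y + 1 / 2)) ^ 2 =
        4 * π ^ 2 * (I * I) * (rot * rot) * (a + y + 1 / 2) ^ 2 := by ring
      rw [this, rot_mul_rot, I_mul_I]; ring
    rw [this]
    field_simp
    ring
  rw [hexp] at hquad
  rw [← hquad, ← integral_const_mul]
  congr 1; ext u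
  have hsin := sin_line_ne_zero N u
  rw [← ha] at hsin
  set x := line a u with hx
  have hx2 : x ^ 2 = a ^ 2 + 2 * a * rot * u + I * u ^ 2 := by
    rw [hx, line, ← rot_mul_rot]; ring
  have h2i : 2 * I * sin (π * x) = cexp (π * I * x) - cexp (-(π * I * x)) := by
    rw [Complex.sin]
    rw [show -(π * x) * I = -(π * I * x) by ring, show π * x * I = π * I * x by ring]
    linear_combination (cexp (-(π * I * x)) - cexp (π * I * x)) * I_mul_I
  have hdiff : expo (y + 1) x - expo y x =
      2 * I * sin (π * x) * cexp (2 * π * I * x * (y + 1 / 2)) := by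
    rw [h2i, expo, expo, sub_mul, ← Complex.exp_add, ← Complex.exp_add]
    ring_nf
  calc ker x * expo (y + 1) x * rot - ker x * expo y x * rot
      = ker x * (expo (y + 1) x - expo y x) * rot := by ring
    _ = cexp (I * π * x ^ 2) * cexp (2 * π * I * x * (y + 1 / 2)) * rot := by
        rw [hdiff, ker]; field_simp
    _ = _ := by
        rw [← Complex.exp_add, mul_comm]
        congr 2
        rw [hx2, hx, line]
        linear_combination (π * u ^ 2 : ℂ) * I_mul_I

lemma ker_add_one (x : ℂ) : ker (x + 1) = ker x * expo 1 x := by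
  have h1 : cexp (I * π * (x + 1) ^ 2) = -(cexp (I * π * x ^ 2) * cexp (2 * π * I * x * 1)) := by
    rw [show I * π * (x + 1) ^ 2 = I * π * x ^ 2 + 2 * π * I * x * 1 + π * I by ring,
      Complex.exp_add, Complex.exp_add, exp_pi_mul_I]
    ring
  rw [ker, ker, expo, h1, mul_add, mul_one, mul_one, sin_add_pi]
  rw [mul_neg, neg_div_neg_eq, mul_div_right_comm]

lemma lineIntegral_succ (N : ℕ) (g : ℂ → ℂ) :
    lineIntegral (N + 1) g = lineIntegral N fun x => expo 1 x * g (x + 1) := by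
  rw [lineIntegral, lineIntegral]
  congr 1; ext u
  have : line ((N + 1 : ℕ) + 1 / 2) u = line (N + 1 / 2) u + 1 := by
    simp [line]; ring
  rw [this, ker_add_one]
  ring

lemma rot_mul_exp_neg : rot * cexp (-(π / 4 * I)) = 1 := by
  rw [rot_eq_exp, ← Complex.exp_add]; simp

/-- Moving the line of integration across the pole at `N + 1`. -/
theorem lineIntegral_succ_sub {N : ℕ} {g : ℂ → ℂ} {U : Set ℂ} (hU : IsOpen U) {A B : ℝ}
    (hB : 0 ≤ B) (hsub : {x : ℂ | x.re - x.im ∈ Icc ((N : ℝ) + 1 / 2) (N + 1 + 1 / 2)} ⊆ U)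
    (hg : DifferentiableOn ℂ g U)
    (hb : ∀ u : ℝ, ∀ c ∈ Icc ((N : ℝ) + 1 / 2) (N + 1 + 1 / 2),
      ‖g (line c u)‖ ≤ Real.exp (A + B * |u|)) :
    lineIntegral (N + 1) g - lineIntegral N g = g (N + 1) := by
  rw [lineIntegral_succ_sub_aux hU hB hsub hg hb, lineIntegral_succ N (fun _ => 1)]
  have h := lineIntegral_expo_add_one N 0
  have h0 : expo 0 = fun _ => 1 := by ext x; simp [expo]
  rw [zero_add, h0, zero_add, show -I * π * (1 / 2) ^ 2 = -(π / 4 * I) by ring,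
    rot_mul_exp_neg] at h
  simp only [mul_one]
  rw [show (fun x => expo 1 x) = expo 1 from rfl, h, mul_one]

/-- The Mordell integral attached to the Riemann–Siegel kernel, in closed form. -/
theorem lineIntegral_expo (y : ℂ) :
    (cexp (2 * π * I * y) - 1) * lineIntegral 0 (expo y) =
      cexp (2 * π * I * y) - cexp (-I * π * y ^ 2 + I * π * y) := by
  have h1 := lineIntegral_expo_add_one 0 y
  have h2 : lineIntegral 1 (expo y) - lineIntegral 0 (expo y) = expo y (0 + 1) := by
    have := lineIntegral_succ_sub (N := 0) (g := expo y) (U := univ) isOpen_univ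
      (A := 2 * π * ‖y‖ * 2) (B := 2 * π * ‖y‖) (by positivity) (subset_univ _)
      (by unfold expo; fun_prop) ?_
    · simpa using this
    · intro u c hc
      refine norm_expo_line_le y ?_ u
      norm_num at hc
      rw [abs_of_nonneg (by linarith [hc.1])]
      linarith [hc.2]
  have h3 : lineIntegral 1 (expo y) = cexp (2 * π * I * y) * lineIntegral 0 (expo (y + 1)) := by
    have hsucc := lineIntegral_succ 0 (expo y)
    rw [zero_add] at hsucc
    rw [hsucc, lineIntegral, lineIntegral, ← integral_const_mul]
    congr 1; ext u
    set x := line ((0 : ℕ) + 1 / 2) u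
    have : expo 1 x * expo y (x + 1) = cexp (2 * π * I * y) * expo (y + 1) x := by
      simp only [expo, ← Complex.exp_add]; congr 1; ring
    rw [this]; ring
  have h4 : cexp (2 * π * I * y) * (rot * cexp (-I * π * (y + 1 / 2) ^ 2)) =
      cexp (-I * π * y ^ 2 + I * π * y) := by
    rw [rot_eq_exp, ← Complex.exp_add, ← Complex.exp_add]; congr 1; ring
  have h5 : expo y (0 + 1) = cexp (2 * π * I * y) := by simp [expo]
  rw [h3, h5] at h2
  linear_combination h2 - cexp (2 * π * I * y) * h1 - h4

lemma mem_slitPlane_of_im_lt_re {x : ℂ} (hx : x.im < x.re) : x ∈ slitPlane := by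
  rw [mem_slitPlane_iff]
  by_cases h : x.im = 0
  · left; linarith
  · exact Or.inr h

lemma line_mem_slitPlane {c : ℝ} (hc : 0 < c) (u : ℝ) : line c u ∈ slitPlane :=
  mem_slitPlane_of_im_lt_re (by simp [hc])

lemma half_sq_le_norm_line_sq (c u : ℝ) : c ^ 2 / 2 ≤ ‖line c u‖ ^ 2 := by
  rw [← normSq_eq_norm_sq, normSq_apply, line_re, line_im]
  nlinarith [sq_nonneg (c + √2 * u), sqrt_two_mul_self]

lemma half_le_norm_line (c u : ℝ) : c / 2 ≤ ‖line c u‖ := by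
  have := half_sq_le_norm_line_sq c u
  nlinarith [norm_nonneg (line c u)]

lemma abs_log_le_add_inv {r : ℝ} (hr : 0 < r) : |Real.log r| ≤ r + r⁻¹ := by
  rw [abs_le]
  have h1 := Real.log_le_sub_one_of_pos hr
  have h2 := Real.log_le_sub_one_of_pos (inv_pos.2 hr)
  rw [Real.log_inv] at h2
  have := inv_pos.2 hr
  constructor <;> linarith

lemma norm_log_line_le {c : ℝ} (hc : 1 / 2 ≤ c) (u : ℝ) : ‖log (line c u)‖ ≤ c + 8 + |u| := by
  have hpos : 1 / 4 ≤ ‖line c u‖ := by linarith [half_le_norm_line c u]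
  have h1 : ‖line c u‖⁻¹ ≤ 4 := by
    rw [inv_le_comm₀ (by linarith) (by norm_num)]; linarith
  have h2 := norm_line_le c u
  rw [abs_of_nonneg (by linarith)] at h2
  have h3 := abs_log_le_add_inv (r := ‖line c u‖) (by linarith)
  refine (norm_le_abs_re_add_abs_im _).trans ?_
  rw [log_re, log_im]
  linarith [abs_arg_le_pi (line c u), Real.pi_lt_four]

lemma norm_cpow_line_le {c : ℝ} (hc : 1 / 2 ≤ c) (s : ℂ) (u : ℝ) :
    ‖line c u ^ (-s)‖ ≤ Real.exp (‖s‖ * (c + 8) + ‖s‖ * |u|) := by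
  rw [cpow_def_of_ne_zero (slitPlane_ne_zero (line_mem_slitPlane (by linarith) u))]
  refine (norm_exp_le_exp_norm _).trans (Real.exp_le_exp.2 ?_)
  rw [norm_mul, norm_neg, mul_comm, ← mul_add]
  gcongr
  exact norm_log_line_le hc u

lemma continuous_cpow_line {c : ℝ} (hc : 0 < c) (s : ℂ) :
    Continuous fun u => line c u ^ (-s) :=
  (continuous_line c).cpow continuous_const fun u => line_mem_slitPlane hc u

lemma continuous_log_line {c : ℝ} (hc : 0 < c) : Continuous fun u => log (line c u) :=
  (continuous_line c).clog fun u => line_mem_slitPlane hc u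

lemma half_le_natCast_add_half (N : ℕ) : (1 : ℝ) / 2 ≤ N + 1 / 2 := by
  linarith [(Nat.cast_nonneg N : (0:ℝ) ≤ N)]

lemma natCast_add_half_pos (N : ℕ) : (0 : ℝ) < N + 1 / 2 := by positivity

/-- The Riemann–Siegel integral over the line of slope `1` through `N + 1/2`. -/
noncomputable def rsIntegral (N : ℕ) (s : ℂ) : ℂ := lineIntegral N fun x => x ^ (-s)

/-- The derivative of the Riemann–Siegel integral. -/
noncomputable def rsIntegralDeriv (N : ℕ) (s : ℂ) : ℂ :=
  lineIntegral N fun x => -log x * x ^ (-s)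

lemma integrable_ker_cpow (N : ℕ) (s : ℂ) : Integrable fun u : ℝ =>
    ker (line (N + 1 / 2) u) * line (N + 1 / 2) u ^ (-s) * rot :=
  integrable_ker_line (g := fun x => x ^ (-s)) (continuous_cpow_line (natCast_add_half_pos N) s)
    (norm_cpow_line_le (half_le_natCast_add_half N) s)

lemma norm_log_mul_cpow_line_le {c : ℝ} (hc : 1 / 2 ≤ c) {s : ℂ} {σ : ℝ} (hs : ‖s‖ + 1 ≤ σ)
    (u : ℝ) : ‖-log (line c u) * line c u ^ (-s)‖ ≤ Real.exp (σ * (c + 8) + σ * |u|) := by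
  have h0 : 0 ≤ c + 8 + |u| := by positivity
  rw [norm_mul, norm_neg]
  calc _ ≤ Real.exp (c + 8 + |u|) * Real.exp (‖s‖ * (c + 8) + ‖s‖ * |u|) := by
        gcongr
        · exact (norm_log_line_le hc u).trans (by linarith [Real.add_one_le_exp (c + 8 + |u|)])
        · exact norm_cpow_line_le hc s u
    _ = Real.exp ((‖s‖ + 1) * (c + 8 + |u|)) := by rw [← Real.exp_add]; congr 1; ring
    _ ≤ Real.exp (σ * (c + 8) + σ * |u|) := by
        rw [← mul_add]; gcongr

lemma integrable_ker_log_cpow (N : ℕ) (s : ℂ) : Integrable fun u : ℝ =>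
    ker (line (N + 1 / 2) u) * (-log (line (N + 1 / 2) u) * line (N + 1 / 2) u ^ (-s)) * rot :=
  integrable_ker_line (g := fun x => -log x * x ^ (-s))
    ((continuous_log_line (natCast_add_half_pos N)).neg.mul
      (continuous_cpow_line (natCast_add_half_pos N) s))
    (norm_log_mul_cpow_line_le (half_le_natCast_add_half N) le_rfl)

theorem hasDerivAt_rsIntegral (N : ℕ) (s : ℂ) :
    HasDerivAt (rsIntegral N) (rsIntegralDeriv N s) s := by
  have hc := natCast_add_half_pos N
  have hc2 := half_le_natCast_add_half N
  set c : ℝ := N + 1 / 2 with hcdef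
  refine (hasDerivAt_integral_of_dominated_loc_of_deriv_le (μ := volume)
    (F := fun s u => ker (line c u) * line c u ^ (-s) * rot)
    (F' := fun s u => ker (line c u) * (-log (line c u) * line c u ^ (-s)) * rot)
    (bound := fun u => Real.exp ((‖s‖ + 2) * (c + 8) + (6 * c + (‖s‖ + 2)) ^ 2) *
      Real.exp (-2 * u ^ 2))
    (Metric.ball_mem_nhds s one_pos) ?_ ?_ ?_ ?_ ?_ ?_).2
  · exact Eventually.of_forall fun s => (integrable_ker_cpow N s).aestronglyMeasurable
  · exact integrable_ker_cpow N s
  · exact (integrable_ker_log_cpow N s).aestronglyMeasurable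
  · refine Eventually.of_forall fun u z hz => ?_
    rw [norm_mul, norm_rot, mul_one, norm_mul]
    refine le_trans ?_ (norm_ker_line_mul_le N ((‖s‖ + 2) * (c + 8)) (‖s‖ + 2) u)
    gcongr
    refine norm_log_mul_cpow_line_le hc2 ?_ u
    have : ‖z‖ ≤ ‖s‖ + ‖z - s‖ := by simpa using norm_add_le s (z - s)
    rw [mem_ball_iff_norm] at hz
    linarith
  · exact integrable_exp_neg_two_mul_sq.const_mul _
  · refine Eventually.of_forall fun u z _ => ?_
    have hx := slitPlane_ne_zero (line_mem_slitPlane hc u)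
    have h := ((hasDerivAt_id z).neg.const_cpow (c := line c u) (Or.inl hx))
    have := (h.const_mul (ker (line c u))).mul_const rot
    refine this.congr_deriv ?_
    simp only [Pi.neg_apply, id]
    ring

/-- Moving the line of integration picks up the initial terms of the zeta series. -/
theorem rsIntegral_eq_add_sum (N : ℕ) (s : ℂ) :
    rsIntegral N s = rsIntegral 0 s + ∑ n ∈ Finset.Ico 1 (N + 1), (n : ℂ) ^ (-s) := by
  induction N with
  | zero => simp
  | succ N ih =>
    have hstep : rsIntegral (N + 1) s - rsIntegral N s = ((N : ℂ) + 1) ^ (-s) := by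
      refine lineIntegral_succ_sub (U := slitPlane) isOpen_slitPlane
        (A := ‖s‖ * (N + 2 + 8)) (B := ‖s‖) (norm_nonneg _) ?_ ?_ ?_
      · intro x hx
        have h0 : (0:ℝ) ≤ N := Nat.cast_nonneg N
        exact mem_slitPlane_of_im_lt_re (by linarith [hx.1])
      · exact fun x hx => ((differentiableAt_id.cpow_const hx)).differentiableWithinAt
      · intro u c hc
        refine (norm_cpow_line_le (by linarith [hc.1, half_le_natCast_add_half N]) s u).trans ?_
        gcongr
        linarith [hc.2]
    rw [Finset.sum_Ico_succ_top (by omega), ← add_assoc, ← ih]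
    push_cast
    linear_combination hstep

lemma integrableOn_rpow_mul_exp_neg_mul {σ b : ℝ} (hσ : 0 < σ) (hb : 0 < b) :
    IntegrableOn (fun t : ℝ => t ^ (σ - 1) * Real.exp (-b * t)) (Ioi 0) := by
  simpa using integrableOn_rpow_mul_exp_neg_mul_rpow (p := 1) (by linarith : -1 < σ - 1) one_pos hb

lemma norm_cpow_mul_exp_neg_mul {a w : ℂ} {t : ℝ} (ht : 0 < t) :
    ‖(t : ℂ) ^ (a - 1) * cexp (-w * t)‖ = t ^ (a.re - 1) * Real.exp (-w.re * t) := by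
  rw [norm_mul, norm_cpow_eq_rpow_re_of_pos ht, norm_exp]
  simp

lemma aestronglyMeasurable_cpow (a : ℂ) {μ : Measure ℝ} :
    AEStronglyMeasurable (fun t : ℝ => (t : ℂ) ^ a) μ :=
  (measurable_ofReal.pow_const a).aestronglyMeasurable

lemma integrableOn_cpow_mul_exp_neg_mul {a w : ℂ} (ha : 0 < a.re) (hw : 0 < w.re) :
    IntegrableOn (fun t : ℝ => (t : ℂ) ^ (a - 1) * cexp (-w * t)) (Ioi 0) := by
  refine Integrable.mono' (integrableOn_rpow_mul_exp_neg_mul ha hw)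
    ((aestronglyMeasurable_cpow _).mul (by fun_prop)) ?_
  filter_upwards [ae_restrict_mem measurableSet_Ioi] with t ht
  exact (norm_cpow_mul_exp_neg_mul ht).le

lemma differentiableAt_integral_cpow_mul_exp {a w : ℂ} (ha : 0 < a.re) (hw : 0 < w.re) :
    DifferentiableAt ℂ (fun w : ℂ => ∫ t : ℝ in Ioi 0, (t : ℂ) ^ (a - 1) * cexp (-w * t)) w := by
  refine (hasDerivAt_integral_of_dominated_loc_of_deriv_le (μ := volume.restrict (Ioi 0))
    (F := fun w (t : ℝ) => (t : ℂ) ^ (a - 1) * cexp (-w * t))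
    (F' := fun w (t : ℝ) => (t : ℂ) ^ (a - 1) * (cexp (-w * t) * (-1 * t)))
    (bound := fun t => t ^ (a.re + 1 - 1) * Real.exp (-(w.re / 2) * t))
    (s := {z | w.re / 2 < z.re}) ?_ ?_ (integrableOn_cpow_mul_exp_neg_mul ha hw) ?_ ?_
    (integrableOn_rpow_mul_exp_neg_mul (by linarith) (by linarith)) ?_).2.differentiableAt
  · exact (isOpen_lt continuous_const continuous_re).mem_nhds (by simp; linarith)
  · exact Eventually.of_forall fun z => (aestronglyMeasurable_cpow _).mul (by fun_prop)
  · exact (aestronglyMeasurable_cpow _).mul (by fun_prop)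
  · filter_upwards [ae_restrict_mem measurableSet_Ioi] with t ht z hz
    have ht : 0 < t := ht
    rw [← mul_assoc, norm_mul, norm_cpow_mul_exp_neg_mul ht, norm_mul, norm_real,
      Real.norm_of_nonneg ht.le, show a.re + 1 - 1 = (a.re - 1) + 1 by ring,
      Real.rpow_add_one ht.ne']
    have hz : w.re / 2 < z.re := hz
    have : Real.exp (-z.re * t) ≤ Real.exp (-(w.re / 2) * t) := by
      apply Real.exp_le_exp.2; nlinarith
    simp only [norm_neg, norm_one, one_mul]
    calc _ = t ^ (a.re - 1) * t * Real.exp (-z.re * t) := by ring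
      _ ≤ _ := by gcongr
  · exact Eventually.of_forall fun t z _ =>
      (((hasDerivAt_neg z).mul_const (t : ℂ)).cexp).const_mul _

lemma div_re_pos {w : ℂ} (hw : 0 < w.re) : 0 < (1 / w).re := by
  rw [one_div, inv_re]
  exact div_pos hw (normSq_pos.2 fun h => by simp [h] at hw)

/-- The Gamma integral with a complex scaling parameter in the right half plane. -/
theorem integral_cpow_mul_exp_neg_mul {a w : ℂ} (ha : 0 < a.re) (hw : 0 < w.re) :
    ∫ t : ℝ in Ioi 0, (t : ℂ) ^ (a - 1) * cexp (-w * t) = (1 / w) ^ a * Gamma a := by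
  have hopen : IsOpen {z : ℂ | 0 < z.re} := isOpen_lt continuous_const continuous_re
  have hf : AnalyticOnNhd ℂ (fun w : ℂ => ∫ t : ℝ in Ioi 0, (t : ℂ) ^ (a - 1) * cexp (-w * t))
      {z : ℂ | 0 < z.re} :=
    DifferentiableOn.analyticOnNhd
      (fun z hz => (differentiableAt_integral_cpow_mul_exp ha hz).differentiableWithinAt) hopen
  have hg : AnalyticOnNhd ℂ (fun w : ℂ => (1 / w) ^ a * Gamma a) {z : ℂ | 0 < z.re} := by
    refine DifferentiableOn.analyticOnNhd (fun z hz => ?_) hopen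
    have hz' : z ≠ 0 := fun h => by simp [h] at hz
    exact ((((differentiableAt_const _).div differentiableAt_id hz').cpow
      (differentiableAt_const _) (Or.inl (div_re_pos (w := z) hz))).mul_const _).differentiableWithinAt
  refine hf.eqOn_of_preconnected_of_frequently_eq hg
    (convex_halfSpace_re_gt 0).isPreconnected (z₀ := 1) (by simp) ?_ hw
  have htend : Tendsto (fun n : ℕ => ((1 + 1 / ((n : ℝ) + 1) : ℝ) : ℂ)) atTop (𝓝[≠] 1) := by
    refine tendsto_nhdsWithin_iff.2 ⟨?_, Eventually.of_forall fun n => ?_⟩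
    · have := (tendsto_one_div_add_atTop_nhds_zero_nat (𝕜 := ℝ)).const_add 1
      rw [add_zero] at this
      exact_mod_cast (continuous_ofReal.tendsto 1).comp this
    · simp only [mem_compl_iff, mem_singleton_iff]
      norm_cast
      have : (0:ℝ) < 1 / ((n : ℝ) + 1) := by positivity
      push_cast
      linarith
  refine htend.frequently (Frequently.of_forall fun n => ?_)
  simp only [neg_mul]
  exact Complex.integral_cpow_mul_exp_neg_mul_Ioi ha
    (by positivity : (0:ℝ) < 1 + 1 / ((n : ℝ) + 1))

/-- The reflected kernel, equal to `-conj (ker (conj x))`. -/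
noncomputable def dualKer (x : ℂ) : ℂ := cexp (-I * π * x ^ 2) / (2 * I * sin (π * x))

lemma conj_rot_mul_self : conj rot * conj rot = -I := by
  rw [← map_mul, rot_mul_rot, conj_I]

lemma two_pi_rot_re (r : ℝ) : (2 * π * rot * r).re = √2 * π * r := by
  rw [re_mul_ofReal]; simp; left; ring

lemma arg_rot : arg rot = π / 4 := by
  rw [rot_eq_exp, show (π / 4 * I : ℂ) = ((π / 4 : ℝ) : ℂ) * I by push_cast; ring, arg_exp_mul_I,
    toIocMod_eq_self]
  constructor <;> linarith [Real.pi_pos]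

lemma arg_two_pi_rot : arg (2 * π * rot) = π / 4 := by
  rw [← arg_rot, ← arg_real_mul rot (by positivity : 0 < 2 * π)]
  push_cast; rfl

lemma two_pi_rot_ne_zero : (2 * π * rot : ℂ) ≠ 0 := by
  simp [rot_ne_zero, Real.pi_ne_zero]

lemma arg_le_pi_div_two_of_im_lt_re {x : ℂ} (hx : x.im < x.re) : arg x ≤ π / 2 := by
  rcases le_or_gt 0 x.re with h | h
  · exact (abs_le.1 (abs_arg_le_pi_div_two_iff.2 h)).2
  · linarith [arg_neg_iff.2 (hx.trans h), Real.pi_pos]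

lemma one_div_two_pi_rot_mul_cpow {x : ℂ} (hx : x.im < x.re) (s : ℂ) :
    (1 / (2 * π * rot * x)) ^ s = (2 * π * rot) ^ (-s) * x ^ (-s) := by
  have hx0 : x ≠ 0 := fun h => by simp [h] at hx
  have h1 := arg_le_pi_div_two_of_im_lt_re hx
  have h2 := neg_pi_lt_arg x
  have hpi := Real.pi_pos
  have hmem : arg (2 * π * rot) + arg x ∈ Ioc (-π) π := by
    rw [arg_two_pi_rot]; constructor <;> linarith
  have hne : arg (2 * π * rot * x) ≠ π := by
    rw [(arg_mul_eq_add_arg_iff two_pi_rot_ne_zero hx0).2 hmem, arg_two_pi_rot]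
    linarith
  rw [one_div, inv_cpow _ _ hne, ← cpow_neg, cpow_def_of_ne_zero (mul_ne_zero two_pi_rot_ne_zero hx0),
    log_mul two_pi_rot_ne_zero hx0 hmem, add_mul, Complex.exp_add,
    ← cpow_def_of_ne_zero two_pi_rot_ne_zero, ← cpow_def_of_ne_zero hx0]

lemma norm_exp_neg_two_pi_rot_lt_one {r : ℝ} (hr : 0 < r) : ‖cexp (-(2 * π * rot * r))‖ < 1 := by
  rw [norm_exp, neg_re, two_pi_rot_re, Real.exp_lt_one_iff]
  have : 0 < √2 * π * r := by positivity
  linarith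

/-- The closed form of the integral of the kernel against an exponential along the ray. -/
lemma lineIntegral_expo_ray {r : ℝ} (hr : 0 < r) :
    lineIntegral 0 (expo (-(conj rot) * r)) =
      dualKer (conj rot * r) - 1 / (cexp (2 * π * rot * r) - 1) := by
  have h := lineIntegral_expo (-(conj rot) * r)
  set E := cexp (π * rot * r) with hE
  have hE0 : E ≠ 0 := exp_ne_zero _
  have hE2 : cexp (2 * π * rot * r) = E ^ 2 := by
    rw [hE, ← Complex.exp_nat_mul]; push_cast; ring_nf
  have hq : cexp (2 * π * I * (-(conj rot) * r)) = (E ^ 2)⁻¹ := by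
    rw [← hE2, ← Complex.exp_neg]
    congr 1
    linear_combination (-2 * π * r) * I_mul_conj_rot
  have hhalf : cexp (-I * π * (-(conj rot) * r) ^ 2 + I * π * (-(conj rot) * r)) =
      cexp (-I * π * (conj rot * r) ^ 2) * E⁻¹ := by
    rw [hE, ← Complex.exp_neg, ← Complex.exp_add]
    congr 1
    linear_combination (-π * r) * I_mul_conj_rot
  have hsin : 2 * I * sin (π * (conj rot * r)) = E - E⁻¹ := by
    have h1 : π * (conj rot * r) * I = π * rot * r := by
      linear_combination (π * r) * I_mul_conj_rot
    rw [Complex.sin, neg_mul, h1, Complex.exp_neg, ← hE]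
    linear_combination (E⁻¹ - E) * I_sq
  have hne : E ^ 2 ≠ 1 := by
    intro h1
    have := norm_exp_neg_two_pi_rot_lt_one hr
    rw [Complex.exp_neg, hE2, h1] at this
    simp at this
  have hne' : E ^ 2 - 1 ≠ 0 := sub_ne_zero.2 hne
  have hne2 : E - E⁻¹ ≠ 0 := by
    rw [show E - E⁻¹ = (E ^ 2 - 1) / E by field_simp]
    exact div_ne_zero hne' hE0
  have hne3 : (E ^ 2)⁻¹ - 1 ≠ 0 := by
    rw [show (E ^ 2)⁻¹ - 1 = -((E ^ 2 - 1) / E ^ 2) by field_simp; ring]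
    exact neg_ne_zero.2 (div_ne_zero hne' (pow_ne_zero 2 hE0))
  rw [hq, hhalf] at h
  rw [dualKer, hsin, hE2]
  apply mul_left_cancel₀ hne3
  rw [h]
  field_simp
  ring

lemma norm_expo_ray (r u : ℝ) :
    ‖expo (-(conj rot) * r) (line (1 / 2) u)‖ = Real.exp (-(√2 / 2 * π) * r) := by
  rw [expo, norm_exp]
  congr 1
  have : 2 * π * I * line (1 / 2) u * (-(conj rot) * r) = -(2 * π * r * (rot * (1 / 2) + I * u)) := by
    rw [line]
    push_cast
    linear_combination (-2 * π * I * r * u) * rot_mul_conj - π * r * I_mul_conj_rot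
  rw [this]
  simp
  ring

lemma expo_ray (r : ℝ) (x : ℂ) : expo (-(conj rot) * r) x = cexp (-(2 * π * rot * x) * r) := by
  rw [expo]
  congr 1
  linear_combination (-2 * π * r * x) * I_mul_conj_rot

lemma rot_mul_line_re (u : ℝ) : (2 * π * rot * line (1 / 2) u).re = √2 / 2 * π := by
  have : 2 * π * rot * line (1 / 2) u = 2 * π * (rot * (1 / 2) + I * u) := by
    rw [line, ← rot_mul_rot]; push_cast; ring
  rw [this]; simp; ring

/-- The Mellin transform integrand is jointly integrable. -/
lemma integrable_mellin_prod {s : ℂ} (hs : 0 < s.re) :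
    Integrable (Function.uncurry fun (r u : ℝ) => (r : ℂ) ^ (s - 1) *
      (ker (line (1 / 2) u) * expo (-(conj rot) * r) (line (1 / 2) u) * rot))
      ((volume.restrict (Ioi 0)).prod volume) := by
  have hker : Integrable fun u : ℝ => ‖ker (line (1 / 2) u)‖ := by
    have := (integrable_ker_mul (N := 0) (h := fun _ => 1) (A := 0) (B := 0) (by fun_prop)
      (by simp)).norm
    simpa using this
  have hkc : Continuous fun u : ℝ => ker (line (1 / 2) u) := by
    simpa using continuous_ker_line 0
  refine Integrable.mono' ((integrableOn_rpow_mul_exp_neg_mul hs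
    (by positivity : 0 < √2 / 2 * π)).mul_prod hker) ?_ ?_
  · have hr : AEStronglyMeasurable (fun p : ℝ × ℝ => (p.1 : ℂ) ^ (s - 1))
        ((volume.restrict (Ioi 0)).prod volume) :=
      ((measurable_ofReal.comp measurable_fst).pow_const (s - 1)).aestronglyMeasurable
    refine hr.mul (Continuous.aestronglyMeasurable ?_)
    have hline := (continuous_line (1 / 2)).comp (continuous_snd (X := ℝ) (Y := ℝ))
    have hkc' := hkc.comp (continuous_snd (X := ℝ) (Y := ℝ))
    simp only [Function.comp_def] at hline hkc'
    unfold expo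
    fun_prop
  · have : ∀ᵐ p : ℝ × ℝ ∂((volume.restrict (Ioi 0)).prod volume), p.1 ∈ Ioi (0:ℝ) :=
      Measure.quasiMeasurePreserving_fst.ae (ae_restrict_mem measurableSet_Ioi)
    filter_upwards [this] with p hp
    rw [Function.uncurry, norm_mul, norm_mul, norm_mul, norm_rot, norm_expo_ray,
      norm_cpow_eq_rpow_re_of_pos hp, sub_re, one_re, mul_one]
    exact le_of_eq (by ring)

lemma integral_mellin_expo {s : ℂ} (hs : 0 < s.re) :
    ∫ r : ℝ in Ioi 0, (r : ℂ) ^ (s - 1) * lineIntegral 0 (expo (-(conj rot) * r)) =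
      (2 * π * rot) ^ (-s) * Gamma s * rsIntegral 0 s := by
  have h := integral_integral_swap (integrable_mellin_prod hs)
  have hl : ∀ r : ℝ, (r : ℂ) ^ (s - 1) * lineIntegral 0 (expo (-(conj rot) * r)) = ∫ u : ℝ,
      (r : ℂ) ^ (s - 1) * (ker (line (1 / 2) u) * expo (-(conj rot) * r) (line (1 / 2) u) * rot) :=
    fun r => by rw [lineIntegral, ← integral_const_mul]; simp
  simp_rw [hl, h, rsIntegral, lineIntegral]
  rw [← integral_const_mul]
  congr 1; ext u
  have h2 := integral_cpow_mul_exp_neg_mul (w := 2 * π * rot * line (1 / 2) u) hs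
    (by rw [rot_mul_line_re]; positivity)
  have h3 : ∀ r : ℝ, (r : ℂ) ^ (s - 1) *
      (ker (line (1 / 2) u) * expo (-(conj rot) * r) (line (1 / 2) u) * rot) =
      (ker (line (1 / 2) u) * rot) *
        ((r : ℂ) ^ (s - 1) * cexp (-(2 * π * rot * line (1 / 2) u) * r)) := fun r => by
    rw [expo_ray]; ring
  simp_rw [h3]
  rw [integral_const_mul, h2, one_div_two_pi_rot_mul_cpow (by simp)]
  simp
  ring

lemma integrableOn_mellin_expo {s : ℂ} (hs : 0 < s.re) : IntegrableOn
    (fun r : ℝ => (r : ℂ) ^ (s - 1) * lineIntegral 0 (expo (-(conj rot) * r))) (Ioi 0) := by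
  have := (integrable_mellin_prod hs).integral_prod_left
  refine this.congr (Eventually.of_forall fun r => ?_)
  simp only [Function.uncurry]
  rw [lineIntegral, ← integral_const_mul]; simp

/-- The Mellin transform of the Bose function along the rotated ray. -/
lemma integral_mellin_bose {s : ℂ} (hs : 1 < s.re) :
    ∫ r : ℝ in Ioi 0, (r : ℂ) ^ (s - 1) * (1 / (cexp (2 * π * rot * r) - 1)) =
      (2 * π * rot) ^ (-s) * Gamma s * riemannZeta s := by
  have hs0 : 0 < s.re := by linarith
  have hw : ∀ n : ℕ, (2 * π * rot * (n + 1)).re = √2 * π * (n + 1) := fun n => by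
    exact_mod_cast two_pi_rot_re (n + 1)
  have hwpos : ∀ n : ℕ, 0 < (2 * π * rot * (n + 1)).re := fun n => by rw [hw]; positivity
  have hsum := hasSum_integral_of_summable_integral_norm (μ := volume.restrict (Ioi (0:ℝ)))
    (F := fun (n : ℕ) (r : ℝ) => (r : ℂ) ^ (s - 1) * cexp (-(2 * π * rot * (n + 1)) * r))
    (fun n => integrableOn_cpow_mul_exp_neg_mul hs0 (hwpos n)) ?_
  · have hterm : ∀ n : ℕ, ∫ r : ℝ in Ioi 0, (r : ℂ) ^ (s - 1) * cexp (-(2 * π * rot * (n + 1)) * r)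
        = (2 * π * rot) ^ (-s) * Gamma s * (1 / ((n : ℂ) + 1) ^ s) := fun n => by
      have hn : ((n : ℂ) + 1).im < ((n : ℂ) + 1).re := by simp; positivity
      rw [integral_cpow_mul_exp_neg_mul hs0 (hwpos n), one_div_two_pi_rot_mul_cpow hn,
        cpow_neg ((n : ℂ) + 1)]
      ring
    simp_rw [hterm] at hsum
    rw [zeta_eq_tsum_one_div_nat_add_one_cpow hs, ← tsum_mul_left, hsum.tsum_eq]
    refine setIntegral_congr_fun measurableSet_Ioi fun r hr => ?_
    have hq := norm_exp_neg_two_pi_rot_lt_one hr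
    have hexp : ∀ n : ℕ, cexp (-(2 * π * rot * (n + 1)) * r) =
        cexp (-(2 * π * rot * r)) * cexp (-(2 * π * rot * r)) ^ n := fun n => by
      rw [← Complex.exp_nat_mul, ← Complex.exp_add]; ring_nf
    simp only [hexp]
    rw [tsum_mul_left, tsum_mul_left, tsum_geometric_of_norm_lt_one hq, Complex.exp_neg]
    congr 1
    have h0 := exp_ne_zero (2 * π * rot * r)
    have h1 : cexp (2 * π * rot * r) - 1 ≠ 0 := fun h => by
      rw [Complex.exp_neg, sub_eq_zero.1 h] at hq
      simp at hq
    have h2 : 1 - (cexp (2 * π * rot * r))⁻¹ ≠ 0 := by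
      rw [show 1 - (cexp (2 * π * rot * r))⁻¹ =
        (cexp (2 * π * rot * r) - 1) / cexp (2 * π * rot * r) by field_simp]
      exact div_ne_zero h1 h0
    field_simp
  · have hval : ∀ n : ℕ, ∫ r : ℝ in Ioi 0, ‖(r : ℂ) ^ (s - 1) *
        cexp (-(2 * π * rot * (n + 1)) * r)‖ =
        (1 / (√2 * π)) ^ s.re * Real.Gamma s.re * (1 / ((n : ℝ) + 1) ^ s.re) := fun n => by
      have h1 : ∀ r ∈ Ioi (0:ℝ), ‖(r : ℂ) ^ (s - 1) * cexp (-(2 * π * rot * (n + 1)) * r)‖ =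
          r ^ (s.re - 1) * Real.exp (-(√2 * π * (n + 1) * r)) := fun r hr => by
        rw [norm_cpow_mul_exp_neg_mul hr, hw, neg_mul]
      rw [setIntegral_congr_fun measurableSet_Ioi h1,
        Real.integral_rpow_mul_exp_neg_mul_Ioi hs0 (by positivity), ← one_div_mul_one_div,
        Real.mul_rpow (by positivity) (by positivity),
        Real.div_rpow zero_le_one (by positivity : (0:ℝ) ≤ (n:ℝ) + 1), Real.one_rpow]
      ring
    simp_rw [hval]
    refine Summable.mul_left _ ?_
    exact_mod_cast (summable_nat_add_iff 1).2 (Real.summable_one_div_nat_rpow.2 hs)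

lemma sin_conj_rot_lower (r : ℝ) : √2 / 2 * π * |r| ≤ ‖sin (π * (conj rot * r))‖ := by
  refine le_trans (le_of_eq ?_) (abs_im_le_norm_sin _)
  simp [abs_mul, abs_of_pos Real.pi_pos, abs_div, abs_of_nonneg (Real.sqrt_nonneg 2)]
  ring

lemma norm_dualKer_ray_le {r : ℝ} (hr : 0 < r) :
    ‖dualKer (conj rot * r)‖ ≤ r⁻¹ * Real.exp (-π * r ^ 2) := by
  have hexp : cexp (-I * π * (conj rot * r) ^ 2) = ((Real.exp (-π * r ^ 2) : ℝ) : ℂ) := by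
    push_cast
    congr 1
    linear_combination (-I * π * r ^ 2) * conj_rot_mul_self + π * r ^ 2 * I_sq
  have hs := sin_conj_rot_lower r
  rw [abs_of_pos hr] at hs
  rw [dualKer, hexp, norm_div, norm_real, Real.norm_of_nonneg (Real.exp_pos _).le, mul_comm r⁻¹,
    ← div_eq_mul_inv]
  gcongr
  rw [norm_mul, norm_mul, norm_I]
  norm_num
  have : 1 ≤ √2 := Real.one_le_sqrt.2 one_le_two
  nlinarith [Real.pi_gt_three, mul_pos hr Real.pi_pos, mul_le_mul_of_nonneg_right this
    (mul_pos hr Real.pi_pos).le]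

lemma integrableOn_mellin_dualKer {s : ℂ} (hs : 1 < s.re) :
    IntegrableOn (fun r : ℝ => (r : ℂ) ^ (s - 1) * dualKer (conj rot * r)) (Ioi 0) := by
  have h := integrableOn_rpow_mul_exp_neg_mul_sq Real.pi_pos (by linarith : -1 < s.re - 2)
  refine Integrable.mono' h ((aestronglyMeasurable_cpow _).mul ?_) ?_
  · refine Measurable.aestronglyMeasurable ?_
    unfold dualKer
    fun_prop
  · filter_upwards [ae_restrict_mem measurableSet_Ioi] with r hr
    have hr : 0 < r := hr
    rw [norm_mul, norm_cpow_eq_rpow_re_of_pos hr, sub_re, one_re,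
      show s.re - 2 = s.re - 1 - 1 by ring, Real.rpow_sub_one hr.ne' (s.re - 1), div_eq_mul_inv,
      mul_assoc]
    gcongr
    exact norm_dualKer_ray_le hr

/-- The Mellin transform of the reflected kernel along the rotated ray. -/
theorem integral_mellin_dualKer {s : ℂ} (hs : 1 < s.re) :
    ∫ r : ℝ in Ioi 0, (r : ℂ) ^ (s - 1) * dualKer (conj rot * r) =
      (2 * π * rot) ^ (-s) * Gamma s * (rsIntegral 0 s + riemannZeta s) := by
  have hs0 : 0 < s.re := by linarith
  rw [mul_add, ← integral_mellin_expo hs0, ← integral_mellin_bose hs, ← sub_eq_iff_eq_add',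
    ← integral_sub (integrableOn_mellin_dualKer hs) (integrableOn_mellin_expo hs0)]
  refine setIntegral_congr_fun measurableSet_Ioi fun r hr => ?_
  simp only [lineIntegral_expo_ray hr]
  ring

/-- The reflection of the Riemann–Siegel integral across the critical line. -/
noncomputable def rsDual (s : ℂ) : ℂ := -conj (rsIntegral 0 (conj (1 - s)))

/-- The integrand of the reflected integral in the rotated coordinate. -/
noncomputable def dualIntegrand (s w : ℂ) : ℂ := (conj rot * w) ^ (s - 1) * dualKer (conj rot * w)

lemma dualKer_conj (x : ℂ) : dualKer (conj x) = -conj (ker x) := by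
  rw [dualKer, ker, map_div₀, ← exp_conj, map_mul, map_mul, map_mul, map_mul, ← sin_conj, map_mul,
    map_pow, conj_I, conj_ofReal, ← div_neg]
  simp [map_ofNat (starRingEnd ℂ) 2]

lemma conj_rot_mul_eq_conj_line (u : ℝ) :
    conj rot * ((u + √2 / 4 : ℝ) + (√2 / 4 : ℝ) * I) = conj (line (1 / 2) u) := by
  apply Complex.ext
  · simp; linear_combination (1 / 4) * sqrt_two_mul_self
  · simp; ring

lemma rsDual_eq_integral (s : ℂ) :
    rsDual s = conj rot * ∫ u : ℝ, dualIntegrand s (u + (√2 / 4 : ℝ) * I) := by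
  rw [← integral_add_right_eq_self _ (√2 / 4), ← integral_const_mul, rsDual, rsIntegral,
    lineIntegral, ← integral_conj, ← integral_neg]
  congr 1; ext u
  rw [dualIntegrand, conj_rot_mul_eq_conj_line, dualKer_conj,
    show s - 1 = conj (-conj (1 - s)) by simp, conj_cpow_eq_ite, if_neg]
  · simp; ring
  · simpa using (mem_slitPlane_iff_arg.1 (line_mem_slitPlane (c := 1 / 2) (by norm_num) u)).1

lemma conj_rot_mul_re (w : ℂ) : (conj rot * w).re = √2 / 2 * (w.re + w.im) := by simp; ring

lemma conj_rot_mul_im (w : ℂ) : (conj rot * w).im = √2 / 2 * (w.im - w.re) := by simp; ring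

lemma norm_conj_rot_mul (w : ℂ) : ‖conj rot * w‖ = ‖w‖ := by
  rw [norm_mul, norm_conj, norm_rot, one_mul]

lemma two_mul_norm_le_norm_sin {x : ℂ} (hx : |x.re| ≤ 1 / 2) : 2 * ‖x‖ ≤ ‖sin (π * x)‖ := by
  have hpi := Real.pi_pos
  have h1 : 2 * |x.re| ≤ |Real.sin (π * x.re)| := by
    have := Real.mul_abs_le_abs_sin (x := π * x.re) (by
      rw [abs_mul, abs_of_pos hpi]; nlinarith)
    rw [abs_mul, abs_of_pos hpi] at this
    calc 2 * |x.re| = 2 / π * (π * |x.re|) := by field_simp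
      _ ≤ _ := this
  have h2 : π * |x.im| ≤ |Real.sinh (π * x.im)| := by
    have := abs_le_abs_sinh (π * x.im)
    rwa [abs_mul, abs_of_pos hpi] at this
  have h3 := norm_sin_sq (π * x)
  have h4 := Real.pi_gt_three
  rw [re_ofReal_mul, im_ofReal_mul, ← sq_abs (Real.sin _), ← sq_abs (Real.sinh _)] at h3
  have h5 : ‖x‖ ^ 2 = |x.re| ^ 2 + |x.im| ^ 2 := by
    rw [sq_abs, sq_abs, ← normSq_eq_norm_sq, normSq_apply]; ring
  have h6 : (2 * |x.re|) ^ 2 ≤ |Real.sin (π * x.re)| ^ 2 := by gcongr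
  have h7 : (2 * |x.im|) ^ 2 ≤ |Real.sinh (π * x.im)| ^ 2 := by
    have : 2 * |x.im| ≤ π * |x.im| := by gcongr; linarith
    gcongr; linarith
  refine le_of_sq_le_sq ?_ (norm_nonneg _)
  nlinarith

lemma abs_sin_re_le_norm_sin (z : ℂ) : |Real.sin z.re| ≤ ‖sin z‖ := by
  refine abs_le_of_sq_le_sq ?_ (norm_nonneg _)
  rw [norm_sin_sq]
  nlinarith [sq_nonneg (Real.sinh z.im)]

lemma norm_div_le_norm_sin {w : ℂ} (hw : w.im ∈ Icc 0 (√2 / 4)) :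
    ‖w‖ / (1 + 2 * ‖w‖) ≤ ‖sin (π * (conj rot * w))‖ := by
  have hpi := Real.pi_gt_three
  have hn := norm_nonneg w
  have hsum : (conj rot * w).re + (conj rot * w).im = √2 * w.im := by
    rw [conj_rot_mul_re, conj_rot_mul_im]; ring
  have hlo : 0 ≤ (conj rot * w).re + (conj rot * w).im := by
    rw [hsum]; exact mul_nonneg (Real.sqrt_nonneg _) hw.1
  have hhi : (conj rot * w).re + (conj rot * w).im ≤ 1 / 2 := by
    rw [hsum]
    calc √2 * w.im ≤ √2 * (√2 / 4) := by gcongr; exact hw.2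
      _ = 1 / 2 := by linear_combination (1 / 4) * sqrt_two_mul_self
  rw [← norm_conj_rot_mul w] at hn ⊢
  set x := conj rot * w
  rw [div_le_iff₀ (by positivity)]
  rcases le_or_gt |x.re| (1 / 2) with h | h
  · nlinarith [two_mul_norm_le_norm_sin h]
  suffices 1 / 2 ≤ ‖sin (π * x)‖ by nlinarith
  rcases le_or_gt |x.re| (3 / 4) with h' | h'
  · refine le_trans ?_ (abs_sin_re_le_norm_sin _)
    rw [re_ofReal_mul]
    have h1 := Real.mul_le_sin (x := π * (1 - |x.re|)) (by nlinarith) (by nlinarith)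
    have h2 : Real.sin (π * (1 - |x.re|)) = Real.sin (π * |x.re|) := by
      rw [← Real.sin_pi_sub]; ring_nf
    have h3 : |Real.sin (π * x.re)| = |Real.sin (π * |x.re|)| := by
      rcases abs_choice x.re with h | h <;> simp [h]
    rw [h3, ← h2]
    refine le_trans ?_ (le_abs_self _)
    refine le_trans ?_ h1
    rw [show 2 / π * (π * (1 - |x.re|)) = 2 * (1 - |x.re|) by field_simp]
    linarith
  · refine le_trans ?_ (abs_im_le_norm_sin _)
    rw [im_ofReal_mul, abs_mul, abs_of_pos Real.pi_pos]
    have : 1 / 4 ≤ |x.im| := by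
      rcases abs_cases x.re with h1 | h1 <;> rcases abs_cases x.im with h2 | h2 <;> linarith
    nlinarith

lemma norm_cexp_conj_rot (w : ℂ) :
    ‖cexp (-I * π * (conj rot * w) ^ 2)‖ = Real.exp (-π * (w.re ^ 2 - w.im ^ 2)) := by
  have : -I * π * (conj rot * w) ^ 2 = -π * (w * w) := by
    linear_combination (-I * π * w ^ 2) * conj_rot_mul_self + π * w ^ 2 * I_sq
  rw [this, norm_exp]
  congr 1
  simp; ring

lemma norm_dualIntegrand_le {s w : ℂ} (hw : w.im ∈ Icc 0 (√2 / 4)) (hw0 : w ≠ 0) :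
    ‖dualIntegrand s w‖ ≤ Real.exp (π * |s.im|) * Real.exp (-π * (w.re ^ 2 - w.im ^ 2)) *
      (‖w‖ ^ (s.re - 2) * (1 + 2 * ‖w‖)) := by
  have hpos : 0 < ‖w‖ := norm_pos_iff.2 hw0
  have h1 : ‖(conj rot * w) ^ (s - 1)‖ ≤ ‖w‖ ^ (s.re - 1) * Real.exp (π * |s.im|) := by
    refine (norm_cpow_le _ _).trans ?_
    rw [norm_conj_rot_mul, div_eq_mul_inv, ← Real.exp_neg, sub_re, sub_im, one_re, one_im, sub_zero]
    gcongr
    refine (neg_le_abs _).trans ?_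
    rw [abs_mul]
    gcongr
    exact abs_arg_le_pi _
  have h2 : ‖dualKer (conj rot * w)‖ ≤
      Real.exp (-π * (w.re ^ 2 - w.im ^ 2)) * ((1 + 2 * ‖w‖) / ‖w‖) := by
    rw [dualKer, norm_div, norm_cexp_conj_rot, div_eq_mul_inv]
    gcongr
    rw [← inv_div]
    have := norm_div_le_norm_sin hw
    gcongr
    rw [norm_mul, norm_mul, norm_I]
    norm_num
    linarith [norm_nonneg (sin (π * (conj rot * w)))]
  rw [dualIntegrand, norm_mul]
  refine (mul_le_mul h1 h2 (norm_nonneg _) (by positivity)).trans (le_of_eq ?_)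
  have : ‖w‖ ^ (s.re - 1) = ‖w‖ ^ (s.re - 2) * ‖w‖ := by
    rw [← Real.rpow_add_one hpos.ne']; ring_nf
  rw [this]
  field_simp

lemma conj_rot_mul_mem_slitPlane {w : ℂ} (hw : 0 ≤ w.im) (hw0 : w ≠ 0) :
    conj rot * w ∈ slitPlane := by
  rw [mem_slitPlane_iff]
  by_cases h : (conj rot * w).im = 0
  · left
    rw [conj_rot_mul_im] at h
    rw [conj_rot_mul_re]
    have h2 : 0 < √2 / 2 := by positivity
    have hre : w.im = w.re := by
      rcases mul_eq_zero.1 h with h | h <;> linarith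
    have : 0 < w.im := lt_of_le_of_ne hw fun h0 => hw0 (Complex.ext (by simp; linarith) h0.symm)
    exact mul_pos h2 (by linarith)
  · exact Or.inr h

lemma sin_conj_rot_mul_ne_zero {w : ℂ} (hw : w.im ∈ Icc 0 (√2 / 4)) (hw0 : w ≠ 0) :
    sin (π * (conj rot * w)) ≠ 0 := by
  have hpos : 0 < ‖w‖ := norm_pos_iff.2 hw0
  have := norm_div_le_norm_sin hw
  exact norm_pos_iff.1 (lt_of_lt_of_le (by positivity) this)

lemma differentiableAt_dualIntegrand (s : ℂ) {w : ℂ} (hw : w.im ∈ Icc 0 (√2 / 4)) (hw0 : w ≠ 0) :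
    DifferentiableAt ℂ (dualIntegrand s) w := by
  have h1 := sin_conj_rot_mul_ne_zero hw hw0
  have h2 := conj_rot_mul_mem_slitPlane hw.1 hw0
  unfold dualIntegrand dualKer
  refine DifferentiableAt.mul ?_ (DifferentiableAt.div (by fun_prop) (by fun_prop) (by simpa using h1))
  exact DifferentiableAt.cpow (by fun_prop) (by fun_prop) h2

lemma dualIntegrand_zero (s : ℂ) : dualIntegrand s 0 = 0 := by simp [dualIntegrand, dualKer]

lemma continuousOn_dualIntegrand {s : ℂ} (hs : 2 < s.re) :
    ContinuousOn (dualIntegrand s) {z | z.im ∈ Icc 0 (√2 / 4)} := by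
  intro w hw
  by_cases hw0 : w = 0
  · subst hw0
    have hmaj : Tendsto (fun w : ℂ => Real.exp (π * |s.im|) *
        Real.exp (-π * (w.re ^ 2 - w.im ^ 2)) * (‖w‖ ^ (s.re - 2) * (1 + 2 * ‖w‖)))
        (𝓝[{z | z.im ∈ Icc 0 (√2 / 4)}] 0) (𝓝 0) := by
      have hc : ContinuousAt (fun w : ℂ => Real.exp (π * |s.im|) *
        Real.exp (-π * (w.re ^ 2 - w.im ^ 2)) * (‖w‖ ^ (s.re - 2) * (1 + 2 * ‖w‖))) 0 := by
        have : ContinuousAt (fun w : ℂ => ‖w‖ ^ (s.re - 2)) 0 :=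
          continuous_norm.continuousAt.rpow_const (Or.inr (by linarith))
        refine ContinuousAt.mul (by fun_prop) (this.mul (by fun_prop))
      have := hc.tendsto
      simp only [norm_zero] at this
      rw [Real.zero_rpow (by linarith)] at this
      simpa using this.mono_left nhdsWithin_le_nhds
    rw [ContinuousWithinAt, dualIntegrand_zero]
    refine squeeze_zero_norm' ?_ hmaj
    filter_upwards [self_mem_nhdsWithin] with z hz
    by_cases hz0 : z = 0
    · rw [hz0, dualIntegrand_zero, norm_zero]
      positivity
    · exact norm_dualIntegrand_le hz hz0
  · exact (differentiableAt_dualIntegrand s hw hw0).continuousAt.continuousWithinAt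

lemma norm_dualIntegrand_le_gaussian {s : ℂ} (hs : 2 < s.re) : ∃ C, ∀ x : ℝ,
    ∀ y ∈ Icc (0:ℝ) (√2 / 4), ‖dualIntegrand s (x + y * I)‖ ≤ C * Real.exp (-x ^ 2) := by
  refine ⟨Real.exp (π * |s.im|) * Real.exp (π / 8) * 3 * Real.exp ((s.re - 1) ^ 2), fun x y hy => ?_⟩
  set w : ℂ := x + y * I with hwdef
  have hre : w.re = x := by simp [hwdef]
  have him : w.im = y := by simp [hwdef]
  by_cases hw0 : w = 0
  · rw [hw0, dualIntegrand_zero, norm_zero]; positivity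
  refine (norm_dualIntegrand_le (by rwa [him]) hw0).trans ?_
  have hy2 : y ^ 2 ≤ 1 / 8 := by
    have : y ^ 2 ≤ (√2 / 4) ^ 2 := pow_le_pow_left₀ hy.1 hy.2 2
    linarith [sqrt_two_mul_self, (by ring : (√2 / 4) ^ 2 = √2 * √2 / 16)]
  have hw : ‖w‖ ≤ Real.exp |x| := by
    have h1 : ‖w‖ ≤ |x| + |y| := by
      simpa [hre, him] using Complex.norm_le_abs_re_add_abs_im w
    have h2 : |y| ≤ 1 := by rw [← sq_le_one_iff_abs_le_one]; linarith
    linarith [Real.add_one_le_exp |x|]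
  have h1 : ‖w‖ ^ (s.re - 2) ≤ Real.exp ((s.re - 2) * |x|) := by
    refine (Real.rpow_le_rpow (norm_nonneg _) hw (by linarith)).trans (le_of_eq ?_)
    rw [← Real.exp_mul, mul_comm]
  have h2 : 1 + 2 * ‖w‖ ≤ 3 * Real.exp |x| := by
    linarith [Real.one_le_exp (abs_nonneg x)]
  have h3 : Real.exp (-π * (w.re ^ 2 - w.im ^ 2)) ≤ Real.exp (π / 8) * Real.exp (-π * x ^ 2) := by
    rw [← Real.exp_add, hre, him]
    apply Real.exp_le_exp.2
    nlinarith [Real.pi_pos]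
  calc _ ≤ Real.exp (π * |s.im|) * (Real.exp (π / 8) * Real.exp (-π * x ^ 2)) *
        (Real.exp ((s.re - 2) * |x|) * (3 * Real.exp |x|)) := by gcongr
    _ = Real.exp (π * |s.im|) * Real.exp (π / 8) * 3 *
        Real.exp (-π * x ^ 2 + (s.re - 1) * |x|) := by
      rw [Real.exp_add, show (s.re - 1) * |x| = (s.re - 2) * |x| + |x| by ring, Real.exp_add]; ring
    _ ≤ Real.exp (π * |s.im|) * Real.exp (π / 8) * 3 *
        Real.exp ((s.re - 1) ^ 2 + -x ^ 2) := by
      refine mul_le_mul_of_nonneg_left (Real.exp_le_exp.2 ?_) (by positivity)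
      linarith [gaussian_exponent_le (s.re - 1) x, sq_nonneg x]
    _ = _ := by rw [Real.exp_add]; ring

lemma log_conj_rot : log (conj rot) = -(π / 4) * I := by
  rw [rot_eq_exp, ← exp_conj, map_mul, conj_I,
    show (conj (π / 4 : ℂ)) * -I = -(π / 4) * I by simp [map_ofNat (starRingEnd ℂ) 4],
    log_exp] <;> simp <;> linarith [Real.pi_pos]

lemma log_neg_conj_rot : log (-conj rot) = 3 * π / 4 * I := by
  have : -conj rot = cexp (3 * π / 4 * I) := by
    rw [rot_eq_exp, ← exp_conj, map_mul, conj_I,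
      show (conj (π / 4 : ℂ)) * -I = -(π / 4) * I by simp [map_ofNat (starRingEnd ℂ) 4],
      ← mul_neg_one, ← exp_pi_mul_I, ← Complex.exp_add]
    ring_nf
  rw [this, log_exp] <;> simp <;> linarith [Real.pi_pos]

lemma mul_ofReal_cpow {z : ℂ} (hz : z ≠ 0) {r : ℝ} (hr : 0 < r) (s : ℂ) :
    (z * r) ^ s = z ^ s * (r : ℂ) ^ s := by
  have hr' : (r : ℂ) ≠ 0 := ofReal_ne_zero.2 hr.ne'
  rw [cpow_def_of_ne_zero (mul_ne_zero hz hr'), cpow_def_of_ne_zero hz, cpow_def_of_ne_zero hr',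
    mul_comm z, log_ofReal_mul hr hz, add_mul, Complex.exp_add, ofReal_log hr.le, mul_comm]

lemma dualKer_neg (x : ℂ) : dualKer (-x) = -dualKer x := by
  simp [dualKer, div_neg]

lemma conj_rot_ne_zero : conj rot ≠ 0 := by simpa using rot_ne_zero

theorem rsDual_eq_mellin {s : ℂ} (hs : 2 < s.re) :
    rsDual s = 2 * cexp (π * s / 4 * I) * cos (π * s / 2) *
      ∫ r : ℝ in Ioi 0, (r : ℂ) ^ (s - 1) * dualKer (conj rot * r) := by
  obtain ⟨C, hC⟩ := norm_dualIntegrand_le_gaussian hs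
  have hcont := continuousOn_dualIntegrand hs
  have hshift := integral_horizontal_shift (by positivity : (0:ℝ) ≤ √2 / 4) hcont
    (fun z hz => (differentiableAt_dualIntegrand s ⟨hz.1.le, hz.2.le⟩
      (fun h => by simp [h] at hz)).differentiableWithinAt) hC
  rw [rsDual_eq_integral, ← hshift]
  simp only [ofReal_zero, zero_mul, add_zero]
  have hInt : Integrable fun x : ℝ => dualIntegrand s x := by
    have hc : Continuous fun x : ℝ => dualIntegrand s x :=
      hcont.comp_continuous (by fun_prop) (fun x => by simp; positivity)
    refine Integrable.mono' (g := fun x => C * Real.exp (-x ^ 2)) ?_ hc.aestronglyMeasurable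
      (Eventually.of_forall fun x => by simpa using hC x 0 (by simp; positivity))
    simpa using (integrable_exp_neg_mul_sq (b := 1) one_pos).const_mul C
  rw [← intervalIntegral.integral_Iic_add_Ioi (b := 0) hInt.integrableOn hInt.integrableOn,
    ← neg_zero (G := ℝ), ← integral_comp_neg_Ioi, neg_zero]
  have hpos : ∀ r ∈ Ioi (0:ℝ), dualIntegrand s r =
      conj rot ^ (s - 1) * ((r : ℂ) ^ (s - 1) * dualKer (conj rot * r)) := fun r hr => by
    rw [dualIntegrand, mul_ofReal_cpow conj_rot_ne_zero hr, mul_assoc]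
  have hneg : ∀ r ∈ Ioi (0:ℝ), dualIntegrand s ((-r : ℝ) : ℂ) =
      -(-conj rot) ^ (s - 1) * ((r : ℂ) ^ (s - 1) * dualKer (conj rot * r)) := fun r hr => by
    rw [dualIntegrand, ofReal_neg, mul_neg, dualKer_neg, ← neg_mul,
      mul_ofReal_cpow (neg_ne_zero.2 conj_rot_ne_zero) hr]
    ring
  rw [setIntegral_congr_fun measurableSet_Ioi hpos, setIntegral_congr_fun measurableSet_Ioi hneg,
    integral_const_mul, integral_const_mul, ← add_mul, ← mul_assoc]
  congr 1
  rw [cpow_sub _ _ conj_rot_ne_zero, cpow_sub _ _ (neg_ne_zero.2 conj_rot_ne_zero), cpow_one,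
    cpow_one, cpow_def_of_ne_zero conj_rot_ne_zero,
    cpow_def_of_ne_zero (neg_ne_zero.2 conj_rot_ne_zero), log_conj_rot, log_neg_conj_rot,
    Complex.cos, div_neg, neg_neg, mul_add, mul_div_cancel₀ _ conj_rot_ne_zero,
    mul_div_cancel₀ _ conj_rot_ne_zero]
  rw [mul_div_assoc' , mul_assoc (2:ℂ), mul_div_assoc, mul_div_cancel_left₀ _ two_ne_zero, mul_add,
    ← Complex.exp_add, ← Complex.exp_add]
  ring_nf

lemma two_pi_rot_cpow (s : ℂ) :
    (2 * π * rot) ^ (-s) = (2 * π : ℂ) ^ (-s) * cexp (-(π * s / 4 * I)) := by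
  have h : log rot = π / 4 * I := by
    rw [rot_eq_exp, log_exp] <;> simp <;> linarith [Real.pi_pos]
  have h1 := mul_ofReal_cpow rot_ne_zero (by positivity : 0 < 2 * π) (-s)
  push_cast at h1
  rw [mul_comm, h1, cpow_def_of_ne_zero rot_ne_zero, h, mul_comm]
  ring_nf

/-- The Riemann–Siegel formula in a half plane. -/
theorem riemannSiegel_of_two_lt_re {s : ℂ} (hs : 2 < s.re) :
    Gammaℂ s * cos (π * s / 2) * (riemannZeta s + rsIntegral 0 s) = rsDual s := by
  rw [rsDual_eq_mellin hs, integral_mellin_dualKer (by linarith), two_pi_rot_cpow, Gammaℂ_def,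
    Complex.exp_neg]
  have := exp_ne_zero (π * s / 4 * I)
  field_simp
  ring

lemma differentiableAt_rsDual (s : ℂ) : DifferentiableAt ℂ rsDual s := by
  have h : DifferentiableAt ℂ (fun z => conj (rsIntegral 0 (conj z))) (1 - s) :=
    differentiableAt_conj_conj_iff.2 (hasDerivAt_rsIntegral 0 _).differentiableAt
  exact (h.comp s (by fun_prop : DifferentiableAt ℂ (fun s => 1 - s) s)).neg

lemma differentiableAt_Gammaℂ {s : ℂ} (hs : 0 < s.re) : DifferentiableAt ℂ Gammaℂ s := by
  have h1 : DifferentiableAt ℂ Gamma s := differentiableAt_Gamma s fun m h => by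
    rw [h] at hs
    simp at hs
    linarith [(Nat.cast_nonneg m : (0:ℝ) ≤ m)]
  have h2 : DifferentiableAt ℂ (fun s : ℂ => (2 * π : ℂ) ^ (-s)) s :=
    DifferentiableAt.const_cpow (by fun_prop) (Or.inl (by simp [Real.pi_ne_zero]))
  have : Gammaℂ = fun s => 2 * (2 * π : ℂ) ^ (-s) * Gamma s := funext Gammaℂ_def
  rw [this]
  exact (h2.const_mul 2).mul h1

/-- The Riemann–Siegel formula in the open first quadrant. -/
theorem riemannSiegel_of_quadrant {s : ℂ} (hre : 0 < s.re) (him : 0 < s.im) :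
    Gammaℂ s * cos (π * s / 2) * (riemannZeta s + rsIntegral 0 s) = rsDual s := by
  have hopen : IsOpen ({z : ℂ | 0 < z.re} ∩ {z : ℂ | 0 < z.im}) :=
    (isOpen_lt continuous_const continuous_re).inter (isOpen_lt continuous_const continuous_im)
  have hf : AnalyticOnNhd ℂ
      (fun s => Gammaℂ s * cos (π * s / 2) * (riemannZeta s + rsIntegral 0 s))
      ({z : ℂ | 0 < z.re} ∩ {z : ℂ | 0 < z.im}) := by
    refine DifferentiableOn.analyticOnNhd (fun z hz => ?_) hopen
    have hz1 : z ≠ 1 := fun h => by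
      have := hz.2
      simp [h] at this
    exact (((differentiableAt_Gammaℂ hz.1).mul (by fun_prop)).mul
      ((differentiableAt_riemannZeta hz1).add
        (hasDerivAt_rsIntegral 0 z).differentiableAt)).differentiableWithinAt
  have hg : AnalyticOnNhd ℂ rsDual ({z : ℂ | 0 < z.re} ∩ {z : ℂ | 0 < z.im}) :=
    DifferentiableOn.analyticOnNhd
      (fun z _ => (differentiableAt_rsDual z).differentiableWithinAt) hopen
  refine hf.eqOn_of_preconnected_of_eventuallyEq hg
    ((convex_halfSpace_re_gt 0).inter (convex_halfSpace_im_gt 0)).isPreconnected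
    (z₀ := 3 + I) (by simp) ?_ ⟨hre, him⟩
  filter_upwards [(isOpen_lt (continuous_const (y := (2:ℝ))) continuous_re).mem_nhds
    (by simp; norm_num : (3 + I : ℂ) ∈ {z : ℂ | 2 < z.re})] with z hz
  exact riemannSiegel_of_two_lt_re hz

/-- The point of the critical line at height `t`. -/
noncomputable def critPt (t : ℝ) : ℂ := 1 / 2 + I * t

@[simp] lemma critPt_re (t : ℝ) : (critPt t).re = 1 / 2 := by simp [critPt]

@[simp] lemma critPt_im (t : ℝ) : (critPt t).im = t := by simp [critPt]

lemma conj_one_sub_critPt (t : ℝ) : conj (1 - critPt t) = critPt t := by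
  apply Complex.ext
  · simp; norm_num
  · simp

lemma Gammaℝ_conj (s : ℂ) : Gammaℝ (conj s) = conj (Gammaℝ s) := by
  have h := conj_cpow (π : ℂ) (-conj s / 2) (by
    rw [arg_ofReal_of_nonneg Real.pi_pos.le]; exact Real.pi_pos.ne)
  have h2 : conj (2 : ℂ) = 2 := map_ofNat _ 2
  rw [map_div₀, map_neg, conj_conj, conj_ofReal, h2] at h
  rw [Gammaℝ_def, Gammaℝ_def, map_mul, ← Gamma_conj, map_div₀, h, h2]

/-- The phase of the completing Gamma factor. -/
noncomputable def phase (t : ℝ) : ℂ := cexp (I * theta t)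

lemma norm_phase (t : ℝ) : ‖phase t‖ = 1 := by
  rw [phase, mul_comm, norm_exp_ofReal_mul_I]

lemma Gammaℝ_critPt (t : ℝ) : Gammaℝ (critPt t) = ‖Gammaℝ (critPt t)‖ * phase t := by
  have h1 : (π : ℂ) ^ (-critPt t / 2) =
      ((π ^ (-(1 / 4 : ℝ)) : ℝ) : ℂ) * cexp (-(t / 2 * Real.log π) * I) := by
    rw [ofReal_cpow Real.pi_pos.le, cpow_def_of_ne_zero (ofReal_ne_zero.2 Real.pi_ne_zero),
      cpow_def_of_ne_zero (ofReal_ne_zero.2 Real.pi_ne_zero), ← Complex.exp_add, critPt,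
      ofReal_log Real.pi_pos.le]
    congr 1
    push_cast
    ring
  set z : ℂ := 1 / 4 + I * t / 2 with hz
  have h2 : Gamma (critPt t / 2) = ‖Gamma z‖ * cexp ((log (Gamma z)).im * I) := by
    rw [show critPt t / 2 = z by rw [critPt, hz]; ring, log_im, norm_mul_exp_arg_mul_I]
  have h3 : Gammaℝ (critPt t) = ((π ^ (-(1 / 4 : ℝ)) * ‖Gamma z‖ : ℝ) : ℂ) * phase t := by
    rw [Gammaℝ_def, h1, h2, phase, theta, ← hz]
    push_cast
    rw [show I * ((log (Gamma z)).im - t / 2 * Real.log π) =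
      -(t / 2 * Real.log π) * I + (log (Gamma z)).im * I by ring, Complex.exp_add]
    ring
  have h4 : ‖Gammaℝ (critPt t)‖ = π ^ (-(1 / 4 : ℝ)) * ‖Gamma z‖ := by
    rw [h3, norm_mul, norm_phase, norm_real, Real.norm_of_nonneg (by positivity), mul_one]
  rw [h4, ← h3]

lemma Gammaℝ_critPt_ne_zero (t : ℝ) : Gammaℝ (critPt t) ≠ 0 :=
  Gammaℝ_ne_zero_of_re_pos (by simp)

/-- The exact Riemann–Siegel formula for Hardy's function. -/
theorem hardyZ_eq {t : ℝ} (ht : 0 < t) (N : ℕ) :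
    hardyZ t = 2 * (phase t * (∑ n ∈ Finset.Ico 1 (N + 1), (n : ℂ) ^ (-critPt t) -
      rsIntegral N (critPt t))).re := by
  have h := riemannSiegel_of_quadrant (s := critPt t) (by simp) (by simpa)
  set s := critPt t with hs
  have hG := Gammaℝ_critPt_ne_zero t
  have hinv := inv_Gammaℝ_one_sub (s := s) fun n hn => by
    have := congrArg re hn
    simp [hs] at this
    linarith [(Nat.cast_nonneg n : (0:ℝ) ≤ n)]
  have hone : Gammaℝ (1 - s) = conj (Gammaℝ s) := by
    rw [← Gammaℝ_conj, hs]
    nth_rewrite 2 [← conj_one_sub_critPt t]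
    rw [conj_conj]
  have hG' : conj (Gammaℝ s) ≠ 0 := by simpa using hG
  have hmul : Gammaℝ s * (riemannZeta s + rsIntegral 0 s) =
      -conj (Gammaℝ s * rsIntegral 0 s) := by
    have h5 : Gammaℂ s * cos (π * s / 2) = Gammaℝ s * (conj (Gammaℝ s))⁻¹ := by
      rw [← hone, hinv, mul_comm (Gammaℝ s), inv_mul_cancel_right₀ hG]
    rw [h5, rsDual, conj_one_sub_critPt, ← hs] at h
    rw [map_mul, ← mul_neg, ← h]
    field_simp
  have hnorm : (‖Gammaℝ s‖ : ℂ) ≠ 0 := by simpa using hG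
  have hphase : phase t * riemannZeta s =
      -conj (phase t * rsIntegral 0 s) - phase t * rsIntegral 0 s := by
    apply mul_left_cancel₀ hnorm
    rw [Gammaℝ_critPt t, ← hs] at hmul
    simp only [map_mul, conj_ofReal] at hmul ⊢
    linear_combination hmul
  have hZ : hardyZ t = (phase t * riemannZeta s).re := rfl
  have hI : ∑ n ∈ Finset.Ico 1 (N + 1), (n : ℂ) ^ (-s) - rsIntegral N s = -rsIntegral 0 s := by
    rw [rsIntegral_eq_add_sum N s]; ring
  rw [hZ, hphase, hI, sub_re, neg_re, conj_re, mul_neg, neg_re]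
  ring

/-- The derivative of the phase. -/
noncomputable def phaseVel (t : ℝ) : ℝ := (logDeriv Gammaℝ (critPt t)).re

lemma differentiableAt_Gammaℝ {s : ℂ} (hs : 0 < s.re) : DifferentiableAt ℂ Gammaℝ s := by
  have h := (differentiable_Gammaℝ_inv s).inv (inv_ne_zero (Gammaℝ_ne_zero_of_re_pos hs))
  exact h.congr_of_eventuallyEq (Eventually.of_forall fun z => by simp)

lemma hasDerivAt_critPt (t : ℝ) : HasDerivAt critPt I t := by
  have : HasDerivAt (fun t : ℝ => 1 / 2 + I * (t : ℂ)) (I * (1 : ℝ)) t :=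
    ((hasDerivAt_id t).ofReal_comp.const_mul I).const_add (1 / 2)
  rwa [ofReal_one, mul_one] at this

lemma hasDerivAt_phase (t : ℝ) : HasDerivAt phase (I * phaseVel t * phase t) t := by
  set G : ℝ → ℂ := fun t => Gammaℝ (critPt t) with hGdef
  have hG : HasDerivAt G (deriv Gammaℝ (critPt t) * I) t :=
    (differentiableAt_Gammaℝ (by simp)).hasDerivAt.comp t (hasDerivAt_critPt t)
  have hne : ∀ t, G t ≠ 0 := Gammaℝ_critPt_ne_zero
  have hphase : phase = fun t => G t / (‖G t‖ : ℂ) := funext fun t => by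
    have h0 : (‖G t‖ : ℂ) ≠ 0 := by simpa using hne t
    rw [eq_div_iff h0, mul_comm]
    exact (Gammaℝ_critPt t).symm
  set D := deriv Gammaℝ (critPt t) * I with hD
  have hsq := hG.norm_sq
  have hnorm : HasDerivAt (fun t => ‖G t‖) ((conj (G t) * D).re / ‖G t‖) t := by
    have h1 := hsq.sqrt (by simpa using hne t)
    simp only [Real.sqrt_sq (norm_nonneg _)] at h1
    convert h1 using 1
    rw [Complex.inner]
    field_simp
  have h0 : (‖G t‖ : ℂ) ≠ 0 := by simpa using hne t
  have hdiv := hG.div hnorm.ofReal_comp h0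
  rw [hphase]
  refine HasDerivAt.congr_deriv hdiv ?_
  have hre : (((conj (G t) * D).re : ℝ) : ℂ) = (conj (G t) * D + G t * conj D) / 2 := by
    rw [re_eq_add_conj]; simp
  have hvel : (phaseVel t : ℂ) = (-I * D / G t + I * conj D / conj (G t)) / 2 := by
    rw [phaseVel, re_eq_add_conj, logDeriv_apply, hD]
    simp only [map_mul, map_div₀, conj_I]
    have hdef : Gammaℝ (critPt t) = G t := rfl
    rw [hdef]
    linear_combination (deriv Gammaℝ (critPt t) / G t / 2 +
      conj (deriv Gammaℝ (critPt t)) / conj (G t) / 2) * I_sq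
  have hn2 : (‖G t‖ : ℂ) ^ 2 = G t * conj (G t) := by
    rw [mul_conj, normSq_eq_norm_sq]; push_cast; rfl
  have hc : conj (G t) ≠ 0 := by simpa using hne t
  have hG0 := hne t
  rw [ofReal_div, hre, hvel]
  field_simp
  rw [hn2, I_sq]
  ring

theorem deriv_hardyZ {t : ℝ} (ht : 0 < t) (N : ℕ) :
    deriv hardyZ t = 2 * (I * phase t * (∑ n ∈ Finset.Ico 1 (N + 1),
      ((phaseVel t - Real.log n : ℝ) : ℂ) * (n : ℂ) ^ (-critPt t) -
      (phaseVel t * rsIntegral N (critPt t) + rsIntegralDeriv N (critPt t)))).re := by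
  have hterm : ∀ n ∈ Finset.Ico 1 (N + 1), HasDerivAt (fun t => (n : ℂ) ^ (-critPt t))
      ((n : ℂ) ^ (-critPt t) * log n * -I) t := fun n hn => by
    have hn0 : (n : ℂ) ≠ 0 := by
      have := (Finset.mem_Ico.1 hn).1
      exact_mod_cast (by omega : n ≠ 0)
    have h := ((hasDerivAt_neg (critPt t)).const_cpow (c := (n : ℂ)) (Or.inl hn0)).comp t
      (hasDerivAt_critPt t)
    exact h.congr_deriv (by ring)
  have hsum := HasDerivAt.fun_sum hterm
  have hI : HasDerivAt (fun t => rsIntegral N (critPt t)) (rsIntegralDeriv N (critPt t) * I) t :=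
    (hasDerivAt_rsIntegral N _).comp t (hasDerivAt_critPt t)
  have hmain := ((hasDerivAt_phase t).mul (hsum.sub hI))
  have hre := (reCLM.hasFDerivAt.comp_hasDerivAt t hmain).const_mul (2:ℝ)
  have heq : hardyZ =ᶠ[𝓝 t] fun t => 2 * (phase t * (∑ n ∈ Finset.Ico 1 (N + 1),
      (n : ℂ) ^ (-critPt t) - rsIntegral N (critPt t))).re := by
    filter_upwards [lt_mem_nhds ht] with x hx using hardyZ_eq hx N
  rw [heq.deriv_eq]
  refine hre.deriv.trans ?_
  rw [reCLM_apply]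
  congr 2
  simp only [ofReal_sub, sub_mul, Finset.sum_sub_distrib, ← Finset.mul_sum, ← Finset.sum_mul,
    natCast_log]
  have hcomm : ∑ n ∈ Finset.Ico 1 (N + 1), log (n : ℂ) * (n : ℂ) ^ (-critPt t) =
      ∑ n ∈ Finset.Ico 1 (N + 1), (n : ℂ) ^ (-critPt t) * log (n : ℂ) :=
    Finset.sum_congr rfl fun n _ => mul_comm _ _
  rw [hcomm]
  simp only [Pi.sub_apply]
  ring

theorem hasDerivAt_half_log_sq_add {τ : ℝ} (hτ : 0 < τ) (y : ℝ) :
    HasDerivAt (fun y : ℝ => Real.log (y ^ 2 + τ ^ 2) / 2) (y / (y ^ 2 + τ ^ 2)) y := by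
  have hpos : (0 : ℝ) < y ^ 2 + τ ^ 2 := by positivity
  have h := ((((hasDerivAt_id y).pow 2).add_const (τ ^ 2)).log hpos.ne').div_const 2
  refine h.congr_deriv ?_
  simp only [id, Pi.pow_apply, Nat.cast_ofNat, Nat.add_one_sub_one, pow_one]
  field_simp

theorem abs_sub_half_log_le {τ : ℝ} (hτ : 0 < τ) {y : ℝ} (hy : 0 ≤ y) :
    |y / (y ^ 2 + τ ^ 2) -
      (Real.log ((y + 1) ^ 2 + τ ^ 2) / 2 - Real.log (y ^ 2 + τ ^ 2) / 2)| ≤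
      1 / (y ^ 2 + τ ^ 2) := by
  obtain ⟨ξ, ⟨h1, h2⟩, h⟩ := exists_hasDerivAt_eq_slope
    (fun y : ℝ => Real.log (y ^ 2 + τ ^ 2) / 2) (fun y => y / (y ^ 2 + τ ^ 2))
    (lt_add_one y)
    (fun x _ => (hasDerivAt_half_log_sq_add hτ x).continuousAt.continuousWithinAt)
    (fun x _ => hasDerivAt_half_log_sq_add hτ x)
  simp only [add_sub_cancel_left, div_one] at h
  rw [← h]
  have hp : (0 : ℝ) < y ^ 2 + τ ^ 2 := by positivity
  have hq : (0 : ℝ) < ξ ^ 2 + τ ^ 2 := by positivity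
  have e : y / (y ^ 2 + τ ^ 2) - ξ / (ξ ^ 2 + τ ^ 2) =
      ((ξ - y) * (ξ * y - τ ^ 2) / (ξ ^ 2 + τ ^ 2)) / (y ^ 2 + τ ^ 2) := by
    field_simp
    ring
  rw [e, abs_div, abs_of_pos hp]
  gcongr
  rw [abs_div, abs_of_pos hq, div_le_one hq, abs_mul, abs_of_pos (by linarith : 0 < ξ - y)]
  have : |ξ * y - τ ^ 2| ≤ ξ ^ 2 + τ ^ 2 := by
    rw [abs_le]; constructor <;> nlinarith
  nlinarith [abs_nonneg (ξ * y - τ ^ 2)]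

theorem inv_sq_add_sq_le {τ σ : ℝ} (hτ : 2 ≤ τ) (hσ : 0 ≤ σ) (j : ℕ) :
    1 / ((σ + j) ^ 2 + τ ^ 2) ≤ 2 * (1 / (j + τ - 1) - 1 / ((j + 1 : ℕ) + τ - 1)) := by
  have hj : (0 : ℝ) ≤ j := j.cast_nonneg
  have h1 : 0 < j + τ - 1 := by linarith
  have h2 : 0 < j + τ := by linarith
  have e : 2 * (1 / (j + τ - 1) - 1 / ((j + 1 : ℕ) + τ - 1)) =
      2 / ((j + τ - 1) * (j + τ)) := by
    push_cast
    have : (j : ℝ) + 1 + τ - 1 = j + τ := by ring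
    rw [this]
    field_simp
    ring
  rw [e, div_le_div_iff₀ (by positivity) (by positivity)]
  nlinarith [sq_nonneg ((j : ℝ) - τ), mul_nonneg hσ hj, sq_nonneg σ]

theorem abs_sum_sub_half_log_le {τ σ : ℝ} (hτ : 2 ≤ τ) (hσ : 0 ≤ σ) (m : ℕ) :
    |∑ j ∈ Finset.range m, (σ + j) / ((σ + j) ^ 2 + τ ^ 2) -
      (Real.log ((σ + m) ^ 2 + τ ^ 2) / 2 - Real.log (σ ^ 2 + τ ^ 2) / 2)| ≤ 4 / τ := by
  have hτ0 : 0 < τ := by linarith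
  have tel : Real.log ((σ + m) ^ 2 + τ ^ 2) / 2 - Real.log (σ ^ 2 + τ ^ 2) / 2 =
      ∑ j ∈ Finset.range m, (Real.log ((σ + j + 1) ^ 2 + τ ^ 2) / 2 -
        Real.log ((σ + j) ^ 2 + τ ^ 2) / 2) := by
    have := Finset.sum_range_sub (fun j : ℕ => Real.log ((σ + j) ^ 2 + τ ^ 2) / 2) m
    simp only [Nat.cast_add, Nat.cast_one, Nat.cast_zero, add_zero, ← add_assoc] at this
    exact this.symm
  rw [tel, ← Finset.sum_sub_distrib]
  calc _ ≤ ∑ j ∈ Finset.range m, 2 * (1 / ((j : ℝ) + τ - 1) - 1 / ((j + 1 : ℕ) + τ - 1)) := by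
        refine (Finset.abs_sum_le_sum_abs _ _).trans (Finset.sum_le_sum fun j _ => ?_)
        exact (abs_sub_half_log_le hτ0 (by positivity)).trans (inv_sq_add_sq_le hτ hσ j)
    _ = 2 * (1 / (τ - 1) - 1 / (m + τ - 1)) := by
        rw [← Finset.mul_sum, Finset.sum_range_sub' (fun j : ℕ => 1 / ((j : ℝ) + τ - 1))]
        simp
    _ ≤ 2 * (1 / (τ - 1)) := by
        have : 0 ≤ 1 / ((m : ℝ) + τ - 1) := by
          have : (0 : ℝ) ≤ m := m.cast_nonneg
          apply div_nonneg <;> linarith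
        linarith
    _ ≤ 4 / τ := by
        rw [mul_one_div, div_le_div_iff₀ (by linarith) hτ0]
        linarith

/-- The logarithm of the modulus of the Euler product approximating `Γ (σ + iτ)`. -/
noncomputable def logGammaSeq (τ : ℝ) (n : ℕ) (σ : ℝ) : ℝ :=
  σ * Real.log n + Real.log n.factorial -
    ∑ j ∈ Finset.range (n + 1), Real.log ((σ + j) ^ 2 + τ ^ 2) / 2

theorem log_norm_GammaSeq {τ : ℝ} (hτ : 0 < τ) (σ : ℝ) {n : ℕ} (hn : n ≠ 0) :
    Real.log ‖Complex.GammaSeq (σ + I * τ) n‖ = logGammaSeq τ n σ := by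
  have hn' : (0 : ℝ) < n := by positivity
  have hnorm (j : ℕ) : ‖(σ + I * τ + j : ℂ)‖ = √((σ + j) ^ 2 + τ ^ 2) := by
    rw [Complex.norm_eq_sqrt_sq_add_sq]
    simp
  have hpos (j : ℕ) : 0 < (σ + j) ^ 2 + τ ^ 2 := by positivity
  rw [Complex.GammaSeq, norm_div, norm_mul, norm_prod, ← Complex.ofReal_natCast,
    Complex.norm_cpow_eq_rpow_re_of_pos hn', Complex.norm_natCast]
  simp only [hnorm]
  rw [Real.log_div, Real.log_mul, Real.log_rpow hn', Real.log_prod, logGammaSeq]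
  · simp [Real.log_sqrt (hpos _).le]
  · exact fun j _ => (Real.sqrt_pos.2 (hpos j)).ne'
  · exact (Real.rpow_pos_of_pos hn' _).ne'
  · positivity
  · positivity
  · exact (Finset.prod_pos fun j _ => Real.sqrt_pos.2 (hpos j)).ne'

theorem hasDerivAt_logGammaSeq {τ : ℝ} (hτ : 0 < τ) (n : ℕ) (σ : ℝ) :
    HasDerivAt (logGammaSeq τ n)
      (Real.log n - ∑ j ∈ Finset.range (n + 1), (σ + j) / ((σ + j) ^ 2 + τ ^ 2)) σ := by
  have h1 : HasDerivAt (fun σ : ℝ => σ * Real.log n + Real.log n.factorial) (Real.log n) σ := by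
    simpa using ((hasDerivAt_id σ).mul_const (Real.log n)).add_const (Real.log n.factorial)
  refine h1.sub (HasDerivAt.fun_sum fun j _ => ?_)
  simpa using (hasDerivAt_half_log_sq_add hτ (σ + j)).comp_add_const σ j

theorem abs_deriv_logGammaSeq_sub_log_le {τ σ : ℝ} (hτ : 2 ≤ τ) (hσ : 0 ≤ σ) (hσ1 : σ ≤ 1)
    {n : ℕ} (hn : n ≠ 0) :
    |Real.log n - ∑ j ∈ Finset.range (n + 1), (σ + j) / ((σ + j) ^ 2 + τ ^ 2) - Real.log τ| ≤
      5 / τ + Real.log (((n + 2) ^ 2 + τ ^ 2) / n ^ 2) / 2 := by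
  have hτ0 : 0 < τ := by linarith
  have hn' : (0 : ℝ) < n := by positivity
  have h := abs_sum_sub_half_log_le hτ hσ (n + 1)
  have h2 : 0 ≤ Real.log (σ ^ 2 + τ ^ 2) / 2 - Real.log τ ∧
      Real.log (σ ^ 2 + τ ^ 2) / 2 - Real.log τ ≤ 1 / τ := by
    have e : Real.log (σ ^ 2 + τ ^ 2) / 2 - Real.log τ = Real.log (1 + σ ^ 2 / τ ^ 2) / 2 := by
      rw [show 1 + σ ^ 2 / τ ^ 2 = (σ ^ 2 + τ ^ 2) / τ ^ 2 by field_simp; ring,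
        Real.log_div (by positivity) (by positivity), Real.log_pow]
      push_cast; ring
    rw [e]
    constructor
    · have := Real.log_nonneg (by linarith [show 0 ≤ σ ^ 2 / τ ^ 2 by positivity] :
        1 ≤ 1 + σ ^ 2 / τ ^ 2)
      linarith
    · have h3 := Real.log_le_sub_one_of_pos (by positivity : 0 < 1 + σ ^ 2 / τ ^ 2)
      have h4 : σ ^ 2 / τ ^ 2 ≤ 1 / τ := by
        rw [div_le_div_iff₀ (by positivity) hτ0]
        have : σ ^ 2 ≤ 1 := pow_le_one₀ hσ hσ1
        nlinarith
      have : 0 ≤ σ ^ 2 / τ ^ 2 := by positivity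
      linarith
  have h3 : 0 ≤ Real.log ((σ + (n + 1 : ℕ)) ^ 2 + τ ^ 2) / 2 - Real.log n ∧
      Real.log ((σ + (n + 1 : ℕ)) ^ 2 + τ ^ 2) / 2 - Real.log n ≤
      Real.log (((n + 2) ^ 2 + τ ^ 2) / n ^ 2) / 2 := by
    have e : Real.log n = Real.log ((n : ℝ) ^ 2) / 2 := by rw [Real.log_pow]; push_cast; ring
    rw [Real.log_div (by positivity) (by positivity), e]
    push_cast
    constructor
    · have : Real.log ((n : ℝ) ^ 2) ≤ Real.log ((σ + (n + 1)) ^ 2 + τ ^ 2) := by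
        apply Real.log_le_log (by positivity)
        nlinarith
      linarith
    · have : Real.log ((σ + (n + 1)) ^ 2 + τ ^ 2) ≤ Real.log (((n : ℝ) + 2) ^ 2 + τ ^ 2) := by
        apply Real.log_le_log (by positivity)
        nlinarith
      linarith
  have h5 : 5 / τ = 4 / τ + 1 / τ := by ring
  rw [abs_le] at h ⊢
  constructor <;> linarith [h.1, h.2, h2.1, h2.2, h3.1, h3.2]

theorem tendsto_log_div_sq (τ : ℝ) :
    Tendsto (fun n : ℕ => Real.log ((((n : ℝ) + 2) ^ 2 + τ ^ 2) / n ^ 2) / 2) atTop (𝓝 0) := by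
  have h0 : Tendsto (fun n : ℕ => ((n : ℝ))⁻¹) atTop (𝓝 0) := tendsto_inv_atTop_nhds_zero_nat
  have h1 : Tendsto (fun n : ℕ => (1 + 2 * (n : ℝ)⁻¹) ^ 2 + τ ^ 2 * ((n : ℝ)⁻¹) ^ 2) atTop
      (𝓝 ((1 + 2 * 0) ^ 2 + τ ^ 2 * 0 ^ 2)) :=
    ((h0.const_mul 2).const_add 1).pow 2 |>.add ((h0.pow 2).const_mul _)
  have h2 := (h1.log (by norm_num)).div_const 2
  simp only [mul_zero, add_zero, one_pow, ne_eq, OfNat.ofNat_ne_zero, not_false_eq_true, zero_pow,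
    Real.log_one, zero_div] at h2
  refine h2.congr' ?_
  filter_upwards [eventually_ne_atTop 0] with n hn
  have : (n : ℝ) ≠ 0 := by exact_mod_cast hn
  congr 2
  field_simp

theorem abs_log_norm_Gamma_sub_le {τ σ σ' : ℝ} (hτ : 2 ≤ τ) (hσ : 0 < σ) (hσ' : σ ≤ σ')
    (hσ1 : σ' ≤ 1) :
    |Real.log ‖Gamma (σ' + I * τ)‖ - Real.log ‖Gamma (σ + I * τ)‖ - (σ' - σ) * Real.log τ| ≤
      5 / τ * (σ' - σ) := by
  have hτ0 : 0 < τ := by linarith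
  have hlim (x : ℝ) (hx : 0 < x) :
      Tendsto (fun n : ℕ => logGammaSeq τ n x) atTop (𝓝 (Real.log ‖Gamma (x + I * τ)‖)) := by
    have hne : ‖Gamma (x + I * τ)‖ ≠ 0 :=
      norm_ne_zero_iff.2 (Complex.Gamma_ne_zero_of_re_pos (by simpa using hx))
    refine ((Complex.GammaSeq_tendsto_Gamma (x + I * τ)).norm.log hne).congr' ?_
    filter_upwards [eventually_ne_atTop 0] with n hn using log_norm_GammaSeq hτ0 x hn
  have hL := (((hlim σ' (by linarith)).sub (hlim σ hσ)).sub_const ((σ' - σ) * Real.log τ)).abs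
  have hR := ((tendsto_log_div_sq τ).const_add (5 / τ)).mul_const (σ' - σ)
  rw [add_zero] at hR
  refine le_of_tendsto_of_tendsto hL hR ?_
  filter_upwards [eventually_ne_atTop 0] with n hn
  have hd (x : ℝ) : HasDerivAt (fun x => logGammaSeq τ n x - x * Real.log τ)
      (Real.log n - ∑ j ∈ Finset.range (n + 1), (x + j) / ((x + j) ^ 2 + τ ^ 2) - Real.log τ) x :=
    ((hasDerivAt_logGammaSeq hτ0 n x).sub ((hasDerivAt_id x).mul_const _)).congr_deriv (by simp)
  have := (convex_Icc (0 : ℝ) 1).norm_image_sub_le_of_norm_hasDerivWithin_le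
    (fun x _ => (hd x).hasDerivWithinAt)
    (fun x hx => abs_deriv_logGammaSeq_sub_log_le hτ hx.1 hx.2 hn)
    (⟨hσ.le, by linarith⟩ : σ ∈ Icc (0 : ℝ) 1) (⟨by linarith, hσ1⟩ : σ' ∈ Icc (0 : ℝ) 1)
  rw [Real.norm_eq_abs, Real.norm_eq_abs, abs_of_nonneg (by linarith : 0 ≤ σ' - σ)] at this
  rwa [show logGammaSeq τ n σ' - logGammaSeq τ n σ - (σ' - σ) * Real.log τ =
    logGammaSeq τ n σ' - σ' * Real.log τ - (logGammaSeq τ n σ - σ * Real.log τ) by ring]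

theorem hasDerivAt_log_norm_Gammaℝ (t : ℝ) :
    HasDerivAt (fun x : ℝ => Real.log ‖Gammaℝ (x + I * t)‖) (phaseVel t) (1 / 2) := by
  have e : (((1 / 2 : ℝ) : ℂ) + I * t) = critPt t := by simp [critPt]
  have hlin : HasDerivAt (fun x : ℝ => (x : ℂ) + I * t) 1 (1 / 2 : ℝ) := by
    simpa using (hasDerivAt_id (1 / 2 : ℝ)).ofReal_comp.add_const (I * (t : ℂ))
  have hd : HasDerivAt Gammaℝ (deriv Gammaℝ (critPt t)) (((1 / 2 : ℝ) : ℂ) + I * t) := by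
    rw [e]
    exact (differentiableAt_Gammaℝ (by simp)).hasDerivAt
  have hG := hd.comp (1 / 2 : ℝ) hlin
  have hne := Gammaℝ_critPt_ne_zero t
  have h := (hG.norm_sq.log (by
    simpa only [Function.comp, e, ne_eq, pow_eq_zero_iff, OfNat.ofNat_ne_zero, not_false_eq_true,
      norm_eq_zero] using hne)).div_const 2
  have hf : (fun x : ℝ => Real.log ‖Gammaℝ (x + I * t)‖) =
      fun x : ℝ => Real.log (‖(Gammaℝ ∘ fun x : ℝ => (x : ℂ) + I * t) x‖ ^ 2) / 2 := by
    funext x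
    rw [Real.log_pow]
    simp
  rw [hf]
  refine h.congr_deriv ?_
  simp only [Function.comp, e, mul_one, phaseVel, logDeriv_apply, Complex.inner]
  rw [Complex.div_re, ← Complex.normSq_eq_norm_sq]
  simp only [mul_re, conj_re, conj_im]
  ring

theorem abs_phaseVel_sub_le {t : ℝ} (ht : 4 ≤ t) :
    |phaseVel t - Real.log (t / (2 * π)) / 2| ≤ 5 / t := by
  have ht0 : 0 < t := by linarith
  have hlog (x : ℝ) (hx : 0 < x) : Real.log ‖Gammaℝ (x + I * t)‖ =
      -(x / 2) * Real.log π + Real.log ‖Gamma ((x / 2 : ℝ) + I * (t / 2 : ℝ))‖ := by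
    have e : (x + I * t : ℂ) / 2 = (x / 2 : ℝ) + I * (t / 2 : ℝ) := by push_cast; ring
    have e' : (-(x + I * t : ℂ) / 2).re = -(x / 2) := by
      rw [neg_div, e]; simp
    rw [Gammaℝ_def, norm_mul, Complex.norm_cpow_eq_rpow_re_of_pos Real.pi_pos, e', e,
      Real.log_mul (Real.rpow_pos_of_pos Real.pi_pos _).ne', Real.log_rpow Real.pi_pos]
    exact norm_ne_zero_iff.2 (Complex.Gamma_ne_zero_of_re_pos (by simpa using hx))
  have hL := (hasDerivAt_iff_tendsto_slope.1 (hasDerivAt_log_norm_Gammaℝ t)).mono_left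
    (nhdsWithin_mono _ (fun x (hx : x ∈ Ioi (1 / 2 : ℝ)) => (ne_of_gt hx)))
  refine le_of_tendsto (hL.sub_const (Real.log (t / (2 * π)) / 2)).abs ?_
  filter_upwards [Ioc_mem_nhdsGT (by norm_num : (1 / 2 : ℝ) < 1)] with x hx
  have h := abs_log_norm_Gamma_sub_le (τ := t / 2) (σ := 1 / 2 / 2) (σ' := x / 2) (by linarith)
    (by norm_num) (by linarith [hx.1]) (by linarith [hx.2])
  have hpos : 0 < x - 1 / 2 := by linarith [hx.1]
  rw [slope_def_field, hlog x (by linarith [hx.1]), hlog (1 / 2) (by norm_num),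
    ← mul_le_mul_iff_of_pos_right hpos, ← abs_of_pos hpos, ← abs_mul, abs_of_pos hpos]
  have e1 : Real.log (t / (2 * π)) = Real.log (t / 2) - Real.log π := by
    rw [← div_div, Real.log_div (by positivity) (by positivity)]
  rw [e1, sub_mul, div_mul_cancel₀ _ hpos.ne']
  refine le_of_eq_of_le (congrArg abs ?_) (h.trans_eq ?_)
  · ring
  · field_simp

theorem one_add_sqrt_two_mul_add_sq_ge (v : ℝ) : 1 / 2 ≤ 1 + √2 * v + v ^ 2 := by
  nlinarith [sq_nonneg (v + √2 / 2), sqrt_two_mul_self]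

theorem hasDerivAt_arg_line (v : ℝ) :
    HasDerivAt (fun v => arg (line 1 v)) (√2 / 2 / (1 + √2 * v + v ^ 2)) v := by
  have hline : HasDerivAt (line 1) rot v := by
    have : HasDerivAt (fun u : ℝ => ((1 : ℝ) : ℂ) + rot * (u : ℂ)) (rot * (1 : ℝ)) v :=
      ((hasDerivAt_id v).ofReal_comp.const_mul rot).const_add _
    rwa [ofReal_one, mul_one] at this
  have hlog := hline.clog_real (line_mem_slitPlane one_pos v)
  have him := Complex.imCLM.hasFDerivAt.comp_hasDerivAt v hlog
  have hq := one_add_sqrt_two_mul_add_sq_ge v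
  refine (him.congr_deriv ?_).congr_of_eventuallyEq (Eventually.of_forall fun v => ?_)
  · have hsq : normSq (line 1 v) = 1 + √2 * v + v ^ 2 := by
      rw [normSq_apply]
      simp only [line_re, line_im]
      nlinarith [sqrt_two_mul_self]
    simp only [imCLM_apply, div_im, hsq, line_re, line_im, rot_re, rot_im]
    field_simp
    ring
  · simp [Complex.log_im]

theorem abs_arg_line_one_le (v : ℝ) : |arg (line 1 v)| ≤ √2 * |v| := by
  have hb (x : ℝ) (_ : x ∈ (univ : Set ℝ)) : ‖√2 / 2 / (1 + √2 * x + x ^ 2)‖ ≤ √2 := by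
    have hq := one_add_sqrt_two_mul_add_sq_ge x
    have hs : 0 < √2 := by positivity
    rw [Real.norm_eq_abs, abs_of_nonneg (by positivity), div_le_iff₀ (by linarith)]
    nlinarith
  have := convex_univ.norm_image_sub_le_of_norm_hasDerivWithin_le
    (fun x _ => (hasDerivAt_arg_line x).hasDerivWithinAt) hb (mem_univ 0) (mem_univ v)
  simpa [line] using this

theorem arg_line_one_le (v : ℝ) : arg (line 1 v) ≤ √2 / 2 * v + v ^ 2 / 4 := by
  set h : ℝ → ℝ := fun v => √2 / 2 * v + v ^ 2 / 4 - arg (line 1 v) with hdef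
  have hd (x : ℝ) :
      HasDerivAt h (x * (3 / 2 + √2 * x + x ^ 2 / 2) / (1 + √2 * x + x ^ 2)) x := by
    have hq := one_add_sqrt_two_mul_add_sq_ge x
    have h1 : HasDerivAt (fun v : ℝ => √2 / 2 * v + v ^ 2 / 4) (√2 / 2 + x / 2) x := by
      have := ((hasDerivAt_id x).const_mul (√2 / 2)).add (((hasDerivAt_id x).pow 2).div_const 4)
      refine this.congr_deriv ?_
      simp
      ring
    refine (h1.sub (hasDerivAt_arg_line x)).congr_deriv ?_
    rw [eq_div_iff (by linarith), sub_mul, div_mul_cancel₀ _ (by linarith)]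
    linear_combination (x / 2) * sqrt_two_mul_self
  have hq (x : ℝ) : 0 ≤ (3 / 2 + √2 * x + x ^ 2 / 2) / (1 + √2 * x + x ^ 2) := by
    have := one_add_sqrt_two_mul_add_sq_ge x
    apply div_nonneg _ (by linarith)
    nlinarith [sq_nonneg (x + √2), sqrt_two_mul_self]
  have hcont : Continuous h := continuous_iff_continuousAt.2 fun x => (hd x).continuousAt
  have h0 : h 0 = 0 := by simp [hdef, line]
  suffices 0 ≤ h v by simp only [hdef] at this; linarith
  rcases le_total 0 v with hv | hv
  · have := monotoneOn_of_deriv_nonneg (convex_Ici (0 : ℝ)) hcont.continuousOn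
      (fun x _ => (hd x).differentiableAt.differentiableWithinAt) (fun x hx => by
        rw [(hd x).deriv, mul_div_assoc]
        rw [interior_Ici] at hx
        exact mul_nonneg (le_of_lt hx) (hq x))
    exact h0 ▸ this self_mem_Ici hv hv
  · have := antitoneOn_of_deriv_nonpos (convex_Iic (0 : ℝ)) hcont.continuousOn
      (fun x _ => (hd x).differentiableAt.differentiableWithinAt) (fun x hx => by
        rw [(hd x).deriv, mul_div_assoc]
        rw [interior_Iic] at hx
        exact mul_nonpos_of_nonpos_of_nonneg (le_of_lt hx) (hq x))
    exact h0 ▸ this hv self_mem_Iic hv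

theorem arg_line {a : ℝ} (ha : 0 < a) (u : ℝ) : arg (line a u) = arg (line 1 (u / a)) := by
  have : line a u = (a : ℂ) * line 1 (u / a) := by
    have : (a : ℂ) ≠ 0 := by exact_mod_cast ha.ne'
    simp only [line]
    push_cast
    field_simp
  rw [this, arg_real_mul _ ha]

theorem mul_arg_line_le {a t D : ℝ} (ha : 0 < a) (hD : |t - 2 * π * a ^ 2| ≤ D * a) (u : ℝ) :
    t * arg (line a u) ≤ √2 * π * a * u + π * u ^ 2 / 2 + D * √2 * |u| := by
  rw [arg_line ha]
  have h1 := arg_line_one_le (u / a)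
  have h2 := abs_arg_line_one_le (u / a)
  set A := arg (line 1 (u / a))
  have h3 : (t - 2 * π * a ^ 2) * A ≤ (D * a) * (√2 * |u / a|) := by
    refine (le_abs_self _).trans ?_
    rw [abs_mul]
    exact mul_le_mul hD h2 (abs_nonneg _) ((abs_nonneg _).trans hD)
  have h4 : (2 * π * a ^ 2) * A ≤ (2 * π * a ^ 2) * (√2 / 2 * (u / a) + (u / a) ^ 2 / 4) := by
    gcongr
  have e3 : (D * a) * (√2 * |u / a|) = D * √2 * |u| := by
    rw [abs_div, abs_of_pos ha]; field_simp
  have e4 : (2 * π * a ^ 2) * (√2 / 2 * (u / a) + (u / a) ^ 2 / 4) =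
      √2 * π * a * u + π * u ^ 2 / 2 := by
    field_simp; ring
  rw [e3] at h3
  rw [e4] at h4
  linarith

theorem exp_half_gaussian_le (B u : ℝ) :
    Real.exp (-π * u ^ 2 / 2 + B * |u|) ≤ Real.exp (B ^ 2) * Real.exp (-1 * u ^ 2) := by
  rw [← Real.exp_add, Real.exp_le_exp]
  nlinarith [Real.pi_gt_three, sq_abs u, sq_nonneg (B - |u| / 2), sq_nonneg u]

theorem norm_ker_cpow_le {N : ℕ} {t D : ℝ}
    (hD : |t - 2 * π * ((N : ℝ) + 1 / 2) ^ 2| ≤ D * ((N : ℝ) + 1 / 2)) (u : ℝ) :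
    ‖ker (line (N + 1 / 2) u) * line (N + 1 / 2) u ^ (-critPt t)‖ ≤
      (((N : ℝ) + 1 / 2) / 2) ^ (-(1 / 2) : ℝ) *
        Real.exp (-π * u ^ 2 / 2 + D * √2 * |u|) := by
  set a : ℝ := N + 1 / 2 with hadef
  have ha : 0 < a := by positivity
  have hx : line a u ≠ 0 := Complex.slitPlane_ne_zero (line_mem_slitPlane ha u)
  have h1 := norm_ker_line_le N u
  rw [← hadef] at h1
  rw [norm_mul, Complex.norm_cpow_of_ne_zero hx]
  have h2 : ‖line a u‖ ^ (-critPt t).re ≤ (a / 2) ^ (-(1 / 2) : ℝ) := by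
    rw [neg_re, critPt_re]
    exact Real.rpow_le_rpow_of_nonpos (by positivity) (half_le_norm_line a u) (by norm_num)
  rw [neg_im, critPt_im, div_eq_mul_inv, ← Real.exp_neg]
  calc _ ≤ Real.exp (-π * u ^ 2 - √2 * π * a * u) * ((a / 2) ^ (-(1 / 2) : ℝ) *
        Real.exp (√2 * π * a * u + π * u ^ 2 / 2 + D * √2 * |u|)) := by
        gcongr
        have := mul_arg_line_le ha hD u
        linarith
    _ = _ := by
        rw [mul_left_comm, ← Real.exp_add]
        ring_nf

theorem norm_integral_gaussian_le {f : ℝ → ℂ} {K : ℝ}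
    (hf : ∀ u, ‖f u‖ ≤ K * Real.exp (-1 * u ^ 2)) : ‖∫ u, f u‖ ≤ K * √π := by
  have := norm_integral_le_of_norm_le ((integrable_exp_neg_mul_sq one_pos).const_mul K)
    (Eventually.of_forall hf)
  rwa [integral_const_mul, integral_gaussian, div_one] at this

theorem norm_rsIntegral_le {N : ℕ} {t D : ℝ}
    (hD : |t - 2 * π * ((N : ℝ) + 1 / 2) ^ 2| ≤ D * ((N : ℝ) + 1 / 2)) :
    ‖rsIntegral N (critPt t)‖ ≤
      (((N : ℝ) + 1 / 2) / 2) ^ (-(1 / 2) : ℝ) * Real.exp ((D * √2) ^ 2) * √π := by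
  refine norm_integral_gaussian_le fun u => ?_
  rw [norm_mul, norm_rot, mul_one, mul_assoc]
  refine (norm_ker_cpow_le hD u).trans ?_
  gcongr
  exact exp_half_gaussian_le _ u

theorem norm_log_line_le_log_add {a : ℝ} (ha : 2 ≤ a) (u : ℝ) :
    ‖log (line a u)‖ ≤ (Real.log a + π) * Real.exp |u| := by
  have h1 : 1 ≤ ‖line a u‖ := by linarith [half_le_norm_line a u]
  have h2 : ‖line a u‖ ≤ a * Real.exp |u| := by
    have := norm_line_le a u
    rw [abs_of_pos (by linarith : 0 < a)] at this
    nlinarith [Real.add_one_le_exp |u|, abs_nonneg u]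
  have h3 : Real.log ‖line a u‖ ≤ Real.log a + |u| := by
    refine (Real.log_le_log (by linarith) h2).trans_eq ?_
    rw [Real.log_mul (by linarith) (Real.exp_pos _).ne', Real.log_exp]
  have h4 : ‖log (line a u)‖ ≤ |Real.log ‖line a u‖| + |arg (line a u)| := by
    simpa [log_re, log_im] using Complex.norm_le_abs_re_add_abs_im (log (line a u))
  rw [abs_of_nonneg (Real.log_nonneg h1)] at h4
  have h5 := abs_arg_le_pi (line a u)
  have h6 := Real.log_nonneg (by linarith : 1 ≤ a)
  nlinarith [Real.add_one_le_exp |u|, abs_nonneg u, Real.pi_gt_three]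

theorem norm_rsIntegralDeriv_le {N : ℕ} {t D : ℝ} (hN : 2 ≤ N)
    (hD : |t - 2 * π * ((N : ℝ) + 1 / 2) ^ 2| ≤ D * ((N : ℝ) + 1 / 2)) :
    ‖rsIntegralDeriv N (critPt t)‖ ≤ (Real.log ((N : ℝ) + 1 / 2) + π) *
      ((((N : ℝ) + 1 / 2) / 2) ^ (-(1 / 2) : ℝ) * Real.exp ((D * √2 + 1) ^ 2)) * √π := by
  have hN' : (2 : ℝ) ≤ N := by exact_mod_cast hN
  have hlog := Real.log_nonneg (by linarith : (1 : ℝ) ≤ N + 1 / 2)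
  refine norm_integral_gaussian_le fun u => ?_
  have e : ker (line (N + 1 / 2) u) *
      (-log (line (N + 1 / 2) u) * line (N + 1 / 2) u ^ (-critPt t)) * rot =
      -(log (line (N + 1 / 2) u) *
        (ker (line (N + 1 / 2) u) * line (N + 1 / 2) u ^ (-critPt t)) * rot) := by ring
  rw [e, norm_neg, norm_mul, norm_rot, mul_one, norm_mul]
  calc _ ≤ (Real.log ((N : ℝ) + 1 / 2) + π) * Real.exp |u| *
        ((((N : ℝ) + 1 / 2) / 2) ^ (-(1 / 2) : ℝ) *
          Real.exp (-π * u ^ 2 / 2 + D * √2 * |u|)) := by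
        gcongr
        · exact norm_log_line_le_log_add (by linarith) u
        · exact norm_ker_cpow_le hD u
    _ = (Real.log ((N : ℝ) + 1 / 2) + π) * ((((N : ℝ) + 1 / 2) / 2) ^ (-(1 / 2) : ℝ) *
          Real.exp (-π * u ^ 2 / 2 + (D * √2 + 1) * |u|)) := by
        rw [show -π * u ^ 2 / 2 + (D * √2 + 1) * |u| =
          |u| + (-π * u ^ 2 / 2 + D * √2 * |u|) by ring, Real.exp_add |u|]
        ring
    _ ≤ (Real.log ((N : ℝ) + 1 / 2) + π) * ((((N : ℝ) + 1 / 2) / 2) ^ (-(1 / 2) : ℝ) *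
          (Real.exp ((D * √2 + 1) ^ 2) * Real.exp (-1 * u ^ 2))) := by
        gcongr
        exact exp_half_gaussian_le _ u
    _ = _ := by ring

theorem re_I_mul_phase_mul_cpow (t c : ℝ) {n : ℕ} (hn : n ≠ 0) :
    (I * phase t * ((c : ℂ) * (n : ℂ) ^ (-critPt t))).re =
      -(1 / √n * c * Real.sin (theta t - t * Real.log n)) := by
  have hn' : (0 : ℝ) < n := by positivity
  have hpow : (n : ℂ) ^ (-critPt t) =
      ((1 / √n : ℝ) : ℂ) * cexp (((-(t * Real.log n) : ℝ) : ℂ) * I) := by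
    have e : -critPt t = ((-(1 / 2) : ℝ) : ℂ) + -(I * t) := by
      rw [critPt]; push_cast; ring
    rw [e, cpow_add _ _ (by exact_mod_cast hn), ← ofReal_natCast, ← ofReal_cpow hn'.le,
      cpow_def_of_ne_zero (by exact_mod_cast hn'.ne'), ← ofReal_log hn'.le,
      Real.rpow_neg hn'.le, ← Real.sqrt_eq_rpow, one_div]
    congr 2
    push_cast
    ring
  have e : I * phase t * ((c : ℂ) * (n : ℂ) ^ (-critPt t)) =
      ((1 / √n * c : ℝ) : ℂ) * (I * cexp (((theta t - t * Real.log n : ℝ) : ℂ) * I)) := by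
    rw [hpow, phase, show ((theta t - t * Real.log n : ℝ) : ℂ) * I =
      I * theta t + ((-(t * Real.log n) : ℝ) : ℂ) * I by push_cast; ring, Complex.exp_add]
    push_cast
    ring
  rw [e, re_ofReal_mul, I_mul_re, exp_ofReal_mul_I_im]
  ring

theorem sum_one_div_sqrt_le (N : ℕ) : ∑ n ∈ Finset.Ico 1 (N + 1), 1 / √(n : ℝ) ≤ 2 * √N := by
  induction N with
  | zero => simp
  | succ N ih =>
    rw [Finset.sum_Ico_succ_top (by omega)]
    refine (add_le_add_left ih _).trans ?_
    have h1 := Real.sq_sqrt (Nat.cast_nonneg (α := ℝ) N)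
    have h2 := Real.sq_sqrt (Nat.cast_nonneg (α := ℝ) (N + 1))
    have h3 : 0 < √((N + 1 : ℕ) : ℝ) := by positivity
    rw [← sub_nonneg]
    have e : 2 * √((N + 1 : ℕ) : ℝ) - (2 * √N + 1 / √((N + 1 : ℕ) : ℝ)) =
        (√((N + 1 : ℕ) : ℝ) - √N) ^ 2 / √((N + 1 : ℕ) : ℝ) := by
      push_cast at h2 h3 ⊢
      field_simp
      nlinarith
    rw [e]
    positivity

theorem abs_deriv_hardyZ_add_sum_le {t : ℝ} (ht : 0 < t) (N : ℕ) (L : ℝ) :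
    |deriv hardyZ t + 2 * ∑ n ∈ Finset.Ico 1 (N + 1),
        1 / √n * (L - Real.log n) * Real.sin (theta t - t * Real.log n)| ≤
      4 * |phaseVel t - L| * √N +
        2 * (|phaseVel t| * ‖rsIntegral N (critPt t)‖ + ‖rsIntegralDeriv N (critPt t)‖) := by
  set R := (phaseVel t : ℂ) * rsIntegral N (critPt t) + rsIntegralDeriv N (critPt t) with hR
  have hnorm : ‖R‖ ≤ |phaseVel t| * ‖rsIntegral N (critPt t)‖ +
      ‖rsIntegralDeriv N (critPt t)‖ := by
    refine (norm_add_le _ _).trans_eq ?_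
    rw [norm_mul, norm_real, Real.norm_eq_abs]
  have hmain : deriv hardyZ t + 2 * ∑ n ∈ Finset.Ico 1 (N + 1),
        1 / √n * (L - Real.log n) * Real.sin (theta t - t * Real.log n) =
      -(2 * ∑ n ∈ Finset.Ico 1 (N + 1),
        1 / √n * (phaseVel t - L) * Real.sin (theta t - t * Real.log n)) -
      2 * (I * phase t * R).re := by
    rw [deriv_hardyZ ht N, mul_sub (I * phase t), sub_re, Finset.mul_sum, re_sum,
      Finset.sum_congr rfl fun n hn => re_I_mul_phase_mul_cpow t _
        (by have := (Finset.mem_Ico.1 hn).1; omega),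
      ← hR, mul_sub, sub_add_eq_add_sub, ← mul_add, ← Finset.sum_add_distrib, ← mul_neg,
      ← Finset.sum_neg_distrib]
    congr 2
    exact Finset.sum_congr rfl fun n _ => by ring
  have hsum : |∑ n ∈ Finset.Ico 1 (N + 1),
      1 / √n * (phaseVel t - L) * Real.sin (theta t - t * Real.log n)| ≤
      |phaseVel t - L| * (2 * √N) := by
    refine (Finset.abs_sum_le_sum_abs _ _).trans ?_
    refine le_trans ?_ (mul_le_mul_of_nonneg_left (sum_one_div_sqrt_le N) (abs_nonneg _))
    rw [Finset.mul_sum]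
    refine Finset.sum_le_sum fun n _ => ?_
    rw [abs_mul, abs_mul, abs_of_nonneg (by positivity : 0 ≤ 1 / √(n : ℝ)),
      mul_comm (1 / √(n : ℝ))]
    exact mul_le_of_le_one_right (by positivity) (Real.abs_sin_le_one _)
  have hre : |(I * phase t * R).re| ≤ ‖R‖ := by
    refine (abs_re_le_norm _).trans_eq ?_
    rw [norm_mul, norm_mul, norm_I, norm_phase, one_mul, one_mul]
  rw [hmain]
  refine (abs_sub _ _).trans ?_
  rw [abs_neg, abs_mul, abs_mul, abs_two]
  linarith

theorem four_le_log {T : ℝ} (hT : 10 ^ 4 ≤ T) : 4 ≤ Real.log T := by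
  rw [Real.le_log_iff_exp_le (by linarith)]
  have : Real.exp 4 = Real.exp 1 ^ 4 := by rw [← Real.exp_nat_mul]; norm_num
  rw [this]
  have h1 : Real.exp 1 ≤ 10 := by linarith [Real.exp_one_lt_d9]
  linarith [pow_le_pow_left₀ (Real.exp_pos 1).le h1 4]

theorem abs_phaseVel_sub_log_sqrt_le {q t : ℝ} (hq : 10 ≤ q) (hqt : q ^ 4 ≤ t)
    (htq : t ≤ q ^ 4 + q) :
    |phaseVel t - Real.log √(q ^ 4 / (2 * π))| ≤ 6 / q ^ 3 := by
  have hq0 : 0 < q := by linarith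
  have hq4 : 10 ^ 4 ≤ q ^ 4 := pow_le_pow_left₀ (by norm_num) hq 4
  have ht0 : 0 < t := by linarith
  have h1 := abs_phaseVel_sub_le (by linarith : 4 ≤ t)
  have h2 : Real.log (t / (2 * π)) - Real.log (q ^ 4 / (2 * π)) = Real.log (t / q ^ 4) := by
    rw [← Real.log_div (by positivity) (by positivity)]
    congr 1
    field_simp
  have h3 : 0 ≤ Real.log (t / q ^ 4) := Real.log_nonneg ((one_le_div (by positivity)).2 hqt)
  have h4 : Real.log (t / q ^ 4) ≤ 1 / q ^ 3 := by
    refine (Real.log_le_sub_one_of_pos (by positivity)).trans ?_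
    rw [sub_le_iff_le_add, div_le_iff₀ (by positivity)]
    refine htq.trans_eq ?_
    field_simp
    ring
  have h5 : 5 / t ≤ 5 / q ^ 3 := by
    have : q ^ 3 ≤ t := le_trans (by nlinarith [pow_pos hq0 3]) hqt
    gcongr
  have h6 : 6 / q ^ 3 = 5 / q ^ 3 + 1 / q ^ 3 := by ring
  rw [Real.log_sqrt (by positivity)]
  rw [abs_le] at h1 ⊢
  constructor <;> linarith [h1.1, h1.2]

theorem abs_sub_two_pi_mul_sq_le {q t P a : ℝ} (hP : 2 * π * P ^ 2 = q ^ 4) (hqP : q ≤ P)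
    (ha : 10 ≤ a) (haP : |a - P| ≤ 1 / 2) (hqt : q ^ 4 ≤ t) (htq : t ≤ q ^ 4 + q) :
    |t - 2 * π * a ^ 2| ≤ 10 * a := by
  obtain ⟨h1, h2⟩ := abs_le.1 haP
  have hπ := Real.pi_lt_d2
  have h3 : |P ^ 2 - a ^ 2| ≤ a + 1 / 4 := by
    rw [abs_le]; constructor <;> nlinarith
  have e : t - 2 * π * a ^ 2 = (t - q ^ 4) + 2 * π * (P ^ 2 - a ^ 2) := by
    rw [← hP]; ring
  rw [e]
  refine (abs_add_le _ _).trans ?_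
  rw [abs_mul, abs_of_nonneg (by linarith), abs_of_pos Real.two_pi_pos]
  nlinarith [abs_nonneg (P ^ 2 - a ^ 2)]

theorem sqrt_fourth_pow_div_two_pi_bounds (q : ℝ) :
    q ^ 2 / 3 ≤ √(q ^ 4 / (2 * π)) ∧ √(q ^ 4 / (2 * π)) ≤ q ^ 2 / 2 := by
  have hπ3 := Real.pi_gt_three
  have hπ4 := Real.pi_lt_d2
  have hq : 0 ≤ q ^ 4 := by positivity
  refine ⟨Real.le_sqrt_of_sq_le ?_, Real.sqrt_le_iff.2 ⟨by positivity, ?_⟩⟩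
  · rw [le_div_iff₀ (by positivity)]
    nlinarith
  · rw [div_le_iff₀ (by positivity)]
    nlinarith

theorem rpow_neg_half_le {q a : ℝ} (hq : 0 < q) (ha : (q / 4) ^ 2 ≤ a / 2) :
    (a / 2) ^ (-(1 / 2) : ℝ) ≤ 4 * q⁻¹ := by
  calc (a / 2) ^ (-(1 / 2) : ℝ) ≤ ((q / 4) ^ 2) ^ (-(1 / 2) : ℝ) :=
        Real.rpow_le_rpow_of_nonpos (by positivity) ha (by norm_num)
    _ = 4 * q⁻¹ := by
        rw [Real.rpow_neg (by positivity), ← Real.sqrt_eq_rpow, Real.sqrt_sq (by positivity)]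
        field_simp

/-- The implied constant. -/
noncomputable def moserConst : ℝ :=
  24 + 16 * (Real.exp ((10 * √2) ^ 2) * √π) + 16 * (Real.exp ((10 * √2 + 1) ^ 2) * √π)

theorem error_terms_le {q t : ℝ} {N : ℕ} (hq : 10 ≤ q) (hqt : q ^ 4 ≤ t) (htq : t ≤ q ^ 4 + q)
    (hN : N < √(q ^ 4 / (2 * π))) (hN' : √(q ^ 4 / (2 * π)) ≤ N + 1) :
    4 * |phaseVel t - Real.log √(q ^ 4 / (2 * π))| * √N +
      2 * (|phaseVel t| * ‖rsIntegral N (critPt t)‖ + ‖rsIntegralDeriv N (critPt t)‖) ≤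
      moserConst * q⁻¹ * Real.log (q ^ 4) := by
  have hq0 : 0 < q := by linarith
  have hq2 : 10 ^ 2 ≤ q ^ 2 := pow_le_pow_left₀ (by norm_num) hq 2
  have hq3 : 10 ^ 3 ≤ q ^ 3 := pow_le_pow_left₀ (by norm_num) hq 3
  have hq4 : 10 ^ 4 ≤ q ^ 4 := pow_le_pow_left₀ (by norm_num) hq 4
  have hq24 : q ^ 2 ≤ q ^ 4 := pow_le_pow_right₀ (by linarith) (by norm_num)
  have hlogT := four_le_log hq4
  have hvel := abs_phaseVel_sub_log_sqrt_le hq hqt htq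
  have hPsq : 2 * π * √(q ^ 4 / (2 * π)) ^ 2 = q ^ 4 := by
    rw [Real.sq_sqrt (by positivity)]; field_simp
  obtain ⟨hP1, hP2⟩ := sqrt_fourth_pow_div_two_pi_bounds q
  generalize √(q ^ 4 / (2 * π)) = P at *
  have hD : |t - 2 * π * ((N : ℝ) + 1 / 2) ^ 2| ≤ 10 * ((N : ℝ) + 1 / 2) :=
    abs_sub_two_pi_mul_sq_le hPsq (by nlinarith) (by linarith)
      (by rw [abs_le]; constructor <;> linarith) hqt htq
  have hI := norm_rsIntegral_le hD
  have hI' := norm_rsIntegralDeriv_le (by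
    have : (2 : ℝ) ≤ N := by linarith
    exact_mod_cast this) hD
  have hapow : (((N : ℝ) + 1 / 2) / 2) ^ (-(1 / 2) : ℝ) ≤ 4 * q⁻¹ :=
    rpow_neg_half_le hq0 (by linarith [div_pow q 4 2])
  have hlog : Real.log ((N : ℝ) + 1 / 2) + π ≤ 2 * Real.log (q ^ 4) := by
    have := Real.log_le_log (by positivity : (0 : ℝ) < N + 1 / 2)
      (by linarith : (N : ℝ) + 1 / 2 ≤ q ^ 4)
    linarith [Real.pi_lt_d2]
  have hvel' : |phaseVel t| ≤ 2 * Real.log (q ^ 4) := by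
    have h1 : 0 ≤ Real.log P := Real.log_nonneg (by linarith)
    have h2 : Real.log P ≤ Real.log (q ^ 4) := Real.log_le_log (by linarith) (by linarith)
    have h3 := abs_le.1 hvel
    have h4 : 6 / q ^ 3 ≤ 1 := by
      rw [div_le_one (by positivity)]; linarith
    rw [abs_le]
    constructor <;> linarith [h3.1, h3.2]
  have hsqrt : √(N : ℝ) ≤ q := Real.sqrt_le_iff.2 ⟨hq0.le, by linarith⟩
  generalize Real.log (q ^ 4) = L at *
  have hfirst : 4 * |phaseVel t - Real.log P| * √N ≤ 24 * q⁻¹ * L := by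
    calc 4 * |phaseVel t - Real.log P| * √N ≤ 4 * (6 / q ^ 3) * q := by gcongr
      _ = 24 * q⁻¹ * q⁻¹ := by field_simp; norm_num
      _ ≤ 24 * q⁻¹ * L := by
        gcongr
        exact (inv_le_one_of_one_le₀ (by linarith)).trans (by linarith)
  have hI₁ : ‖rsIntegral N (critPt t)‖ ≤ 4 * q⁻¹ * (Real.exp ((10 * √2) ^ 2) * √π) := by
    refine hI.trans ?_
    rw [mul_assoc]
    gcongr
  have hI₂ : ‖rsIntegralDeriv N (critPt t)‖ ≤
      2 * L * (4 * q⁻¹ * (Real.exp ((10 * √2 + 1) ^ 2) * √π)) := by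
    refine hI'.trans ?_
    rw [mul_assoc, mul_assoc]
    gcongr
  calc _ ≤ 24 * q⁻¹ * L + 2 * (2 * L * (4 * q⁻¹ * (Real.exp ((10 * √2) ^ 2) * √π)) +
        2 * L * (4 * q⁻¹ * (Real.exp ((10 * √2 + 1) ^ 2) * √π))) := by gcongr
    _ = _ := by rw [moserConst]; ring

end RiemannSiegel

/-- Moser Formula 2: for `t ∈ [T, T+H]`, `0 < H ≤ T^{1/4}`, with `P₀ = √(T/2π)`,
`Z'(t) = −2·Σ_{1 ≤ n < P₀} n^{-1/2}·ln(P₀/n)·sin(θ(t) − t·ln n) + O(T^{−1/4}·ln T)`. -/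
theorem moser_formula2 :
    ∃ C > (0:ℝ), ∃ T₀ > (0:ℝ), ∀ T : ℝ, T₀ ≤ T → ∀ H : ℝ, 0 < H → H ≤ T ^ ((1:ℝ)/4) →
      ∀ t ∈ Set.Icc T (T + H),
        |deriv hardyZ t +
            2 * ∑ n ∈ Finset.Ico 1 ⌈Real.sqrt (T / (2 * Real.pi))⌉₊,
              (1 / Real.sqrt n) * Real.log (Real.sqrt (T / (2 * Real.pi)) / n) *
                Real.sin (theta t - t * Real.log n)|
          ≤ C * T ^ (-(1:ℝ)/4) * Real.log T := by
  refine ⟨RiemannSiegel.moserConst, by unfold RiemannSiegel.moserConst; positivity,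
    10 ^ 4, by norm_num, ?_⟩
  intro T hT H _ hH t ht
  have hT0 : 0 < T := by linarith
  obtain ⟨q, hq0, rfl⟩ : ∃ q : ℝ, 0 < q ∧ T = q ^ 4 :=
    ⟨T ^ ((1:ℝ)/4), Real.rpow_pos_of_pos hT0 _, by
      rw [← Real.rpow_natCast, ← Real.rpow_mul hT0.le]; norm_num⟩
  have hroot (x : ℝ) : (q ^ 4) ^ (x / 4) = q ^ x := by
    rw [← Real.rpow_natCast, ← Real.rpow_mul hq0.le]
    congr 1
    push_cast
    ring
  rw [hroot, Real.rpow_one] at hH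
  rw [hroot, Real.rpow_neg_one]
  have hq10 : 10 ≤ q := le_of_pow_le_pow_left₀ (by norm_num) hq0.le hT
  have hP := (RiemannSiegel.sqrt_fourth_pow_div_two_pi_bounds q).1
  have hP0 : 0 < √(q ^ 4 / (2 * Real.pi)) := lt_of_lt_of_le (by positivity) hP
  obtain ⟨N, hN⟩ : ∃ N, ⌈√(q ^ 4 / (2 * Real.pi))⌉₊ = N + 1 :=
    Nat.exists_eq_succ_of_ne_zero (Nat.ceil_pos.2 hP0).ne'
  have hN1 : √(q ^ 4 / (2 * Real.pi)) ≤ N + 1 := by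
    have := Nat.le_ceil √(q ^ 4 / (2 * Real.pi))
    rw [hN] at this
    exact_mod_cast this
  have hN2 : (N : ℝ) < √(q ^ 4 / (2 * Real.pi)) := Nat.lt_ceil.1 (by omega)
  have hsum : ∑ n ∈ Finset.Ico 1 (N + 1), 1 / √(n : ℝ) *
      Real.log (√(q ^ 4 / (2 * Real.pi)) / n) * Real.sin (theta t - t * Real.log n) =
      ∑ n ∈ Finset.Ico 1 (N + 1), 1 / √(n : ℝ) *
        (Real.log √(q ^ 4 / (2 * Real.pi)) - Real.log n) *
        Real.sin (theta t - t * Real.log n) :=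
    Finset.sum_congr rfl fun n hn => by
      have hn0 : (n : ℝ) ≠ 0 := by
        have := (Finset.mem_Ico.1 hn).1
        exact_mod_cast (by omega : n ≠ 0)
      rw [Real.log_div hP0.ne' hn0]
  rw [hN, hsum]
  exact (RiemannSiegel.abs_deriv_hardyZ_add_sum_le (hT0.trans_le ht.1) N _).trans
    (RiemannSiegel.error_terms_le hq10 ht.1 (by linarith [ht.2]) hN2 hN1)
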